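/- arXiv:1707.00215 — 4 statements merged into one kernel-verified Lean document; each statement's English description precedes it below -/
import Mathlib

section
/- Let G_D be the presented group on generators a, b, x, y with the four relations a x = y b, a y = y⁻¹ b, b x = x a⁻¹, b y = x⁻¹ a. Then the elements a⁶ and b⁶ are nontrivial in G_D and belong to every finite-index subgroup of G_D. In particular, G_D is not residually finite. -/
namespace JanzenWise

/-- Relators of `π₁(Δ_D)` on the generators `a = 0`, `b = 1`, `x = 2`, `y = 3`,
encoding the relations `a x = y b`, `a y = y⁻¹ b`, `b x = x a⁻¹`, `b y = x⁻¹ a`. -/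
def relsD : Set (FreeGroup (Fin 4)) :=
  { FreeGroup.of 0 * FreeGroup.of 2 * (FreeGroup.of 1)⁻¹ * (FreeGroup.of 3)⁻¹,
    FreeGroup.of 0 * FreeGroup.of 3 * (FreeGroup.of 1)⁻¹ * FreeGroup.of 3,
    FreeGroup.of 1 * FreeGroup.of 2 * FreeGroup.of 0 * (FreeGroup.of 2)⁻¹,
    FreeGroup.of 1 * FreeGroup.of 3 * (FreeGroup.of 0)⁻¹ * FreeGroup.of 2 }

/-- The fundamental group `G_D = π₁(Δ_D)`. -/
abbrev GD := PresentedGroup relsD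

/-- The generator `a` of `G_D`. -/
def a : GD := PresentedGroup.of 0
/-- The generator `b` of `G_D`. -/
def b : GD := PresentedGroup.of 1

end JanzenWise
namespace JanzenWise

/-- An oriented edge: `(i, true)` is the `i`-th edge of its kind, `(i, false)` its reverse.
Horizontal edges are `a`, `b` and vertical edges are `x`, `y`. -/
abbrev Edge := Fin 2 × Bool

/-- The reverse of an oriented edge. -/
def Edge.rev (p : Edge) : Edge := (p.1, !p.2)

/-- The permutation of the vertical edges induced by the horizontal edge `s`: in the square
`s p = p' s'` it sends `p` to `p'`. -/
def edgeTurn : Edge → Edge → Edge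
  | (0, true), (0, true) => (1, true)
  | (0, true), (1, true) => (1, false)
  | (0, true), (1, false) => (0, true)
  | (0, true), (0, false) => (0, false)
  | (0, false), (1, true) => (0, true)
  | (0, false), (1, false) => (1, true)
  | (0, false), (0, true) => (1, false)
  | (0, false), (0, false) => (0, false)
  | (1, true), (0, true) => (0, true)
  | (1, true), (1, true) => (0, false)
  | (1, true), (0, false) => (1, false)
  | (1, true), (1, false) => (1, true)
  | (1, false), (0, true) => (0, true)
  | (1, false), (0, false) => (1, true)
  | (1, false), (1, false) => (0, false)
  | (1, false), (1, true) => (1, false)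

/-- The horizontal edge `s'` opposite to `s` in the square `s p = p' s'`. -/
def edgeSec (s p : Edge) : Edge :=
  (1 - s.1, xor s.2 (p == (0, s.1 == 1)))

lemma Edge.rev_rev (p : Edge) : p.rev.rev = p := by revert p; decide

lemma edgeTurn_rev_edgeTurn (s p : Edge) : edgeTurn s.rev (edgeTurn s p) = p := by
  revert s p; decide

lemma edgeSec_rev_edgeTurn (s p : Edge) : edgeSec s.rev (edgeTurn s p) = (edgeSec s p).rev := by
  revert s p; decide

lemma edgeTurn_edgeSec_rev (s p : Edge) :
    edgeTurn (edgeSec s p) p.rev = (edgeTurn s p).rev := by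
  revert s p; decide

lemma edgeSec_edgeSec_rev (s p : Edge) : edgeSec (edgeSec s p) p.rev = s := by
  revert s p; decide

/-- An oriented edge as an element of the free group on the unoriented ones. -/
def Edge.toFree (s : Edge) : FreeGroup (Fin 2) := FreeGroup.mk [s]

lemma Edge.toFree_rev (s : Edge) : s.rev.toFree = s.toFree⁻¹ := by
  simp [Edge.toFree, Edge.rev, FreeGroup.inv_mk, FreeGroup.invRev]

lemma Edge.toFree_true (i : Fin 2) : Edge.toFree (i, true) = FreeGroup.of i := rfl

lemma Edge.toFree_false (i : Fin 2) : Edge.toFree (i, false) = (FreeGroup.of i)⁻¹ := rfl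

lemma edge_induction {P : FreeGroup (Fin 2) → Prop} (one : P 1)
    (mul : ∀ (s : Edge) f, P f → P (s.toFree * f)) (f : FreeGroup (Fin 2)) : P f := by
  obtain ⟨w, rfl⟩ := Quot.exists_rep f
  induction w with
  | nil => exact one
  | cons s w ih => exact mul s _ ih

/-- Left multiplication by a horizontal edge on the products of a vertical edge and a
horizontal element. -/
def crossEdge (s : Edge) : Equiv.Perm (Edge × FreeGroup (Fin 2)) where
  toFun q := (edgeTurn s q.1, (edgeSec s q.1).toFree * q.2)
  invFun q := (edgeTurn s.rev q.1, (edgeSec s.rev q.1).toFree * q.2)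
  left_inv q := by
    simp [edgeTurn_rev_edgeTurn, edgeSec_rev_edgeTurn, Edge.toFree_rev]
  right_inv q := by
    have h1 := edgeTurn_rev_edgeTurn s.rev q.1
    have h2 := edgeSec_rev_edgeTurn s.rev q.1
    rw [Edge.rev_rev] at h1 h2
    simp [h1, h2, Edge.toFree_rev]

/-- Left multiplication by a horizontal element on the products of a vertical edge and a
horizontal element. -/
def cross : FreeGroup (Fin 2) →* Equiv.Perm (Edge × FreeGroup (Fin 2)) :=
  FreeGroup.lift fun i => crossEdge (i, true)

lemma cross_toFree (s : Edge) : cross s.toFree = crossEdge s := by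
  obtain ⟨i, _ | _⟩ := s
  · rw [Edge.toFree_false, map_inv, cross, FreeGroup.lift_apply_of]
    rfl
  · rw [Edge.toFree_true, cross, FreeGroup.lift_apply_of]

/-- The vertical edge `p'` in `f p = p' f'`. -/
def turn (f : FreeGroup (Fin 2)) (p : Edge) : Edge := (cross f (p, 1)).1

/-- The horizontal element `f'` in `f p = p' f'`. -/
def sec (f : FreeGroup (Fin 2)) (p : Edge) : FreeGroup (Fin 2) := (cross f (p, 1)).2

lemma cross_apply (f : FreeGroup (Fin 2)) (p : Edge) (h : FreeGroup (Fin 2)) :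
    cross f (p, h) = (turn f p, sec f p * h) := by
  induction f using edge_induction with
  | one => simp [turn, sec]
  | mul s f ih =>
    have ih' : cross f (p, 1) = (turn f p, sec f p) := rfl
    rw [turn, sec, map_mul, Equiv.Perm.mul_apply, Equiv.Perm.mul_apply, ih, ih', cross_toFree]
    simp [crossEdge, mul_assoc]

lemma turn_one (p : Edge) : turn 1 p = p := by simp [turn]

lemma sec_one (p : Edge) : sec 1 p = 1 := by simp [sec]

lemma turn_mul (f g : FreeGroup (Fin 2)) (p : Edge) : turn (f * g) p = turn f (turn g p) := by
  rw [turn, map_mul, Equiv.Perm.mul_apply, cross_apply g, cross_apply f]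

lemma sec_mul (f g : FreeGroup (Fin 2)) (p : Edge) :
    sec (f * g) p = sec f (turn g p) * sec g p := by
  rw [sec, map_mul, Equiv.Perm.mul_apply, cross_apply g, cross_apply f, mul_one]

lemma turn_toFree (s p : Edge) : turn s.toFree p = edgeTurn s p := by
  simp [turn, cross_toFree, crossEdge]

lemma sec_toFree (s p : Edge) : sec s.toFree p = (edgeSec s p).toFree := by
  simp [sec, cross_toFree, crossEdge]

lemma turn_bijective (f : FreeGroup (Fin 2)) : Function.Bijective (turn f) :=
  Function.bijective_iff_has_inverse.2 ⟨turn f⁻¹,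
    fun p => by rw [← turn_mul, inv_mul_cancel, turn_one],
    fun p => by rw [← turn_mul, mul_inv_cancel, turn_one]⟩

lemma turn_sec_rev (f : FreeGroup (Fin 2)) (p : Edge) :
    turn (sec f p) p.rev = (turn f p).rev := by
  induction f using edge_induction with
  | one => simp [turn_one, sec_one]
  | mul s f ih =>
    rw [sec_mul, turn_mul, ih, turn_mul, sec_toFree, turn_toFree, turn_toFree,
      edgeTurn_edgeSec_rev]

lemma sec_sec_rev (f : FreeGroup (Fin 2)) (p : Edge) : sec (sec f p) p.rev = f := by
  induction f using edge_induction with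
  | one => simp [sec_one]
  | mul s f ih =>
    rw [sec_mul, sec_mul, ih, turn_sec_rev, sec_toFree, sec_toFree, edgeSec_edgeSec_rev]

/-! ### The action of `GD` on the horizontal tree -/

/-- The action of a vertical edge on the vertices of the horizontal tree. -/
def vertPerm (r : Edge) : Equiv.Perm (FreeGroup (Fin 2)) where
  toFun f := (sec f⁻¹ r.rev)⁻¹
  invFun f := (sec f⁻¹ r)⁻¹
  left_inv f := by
    have := sec_sec_rev f⁻¹ r.rev
    rw [Edge.rev_rev] at this
    simp [this]
  right_inv f := by simp [sec_sec_rev]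

lemma vertPerm_mul {s p p' s' : Edge} (h : edgeTurn s p = p') (h' : edgeSec s p = s')
    (f : FreeGroup (Fin 2)) :
    s.toFree * vertPerm p f = vertPerm p' (s'.toFree * f) := by
  subst h h'
  simp only [vertPerm, Equiv.coe_fn_mk, mul_inv_rev, ← Edge.toFree_rev, sec_mul, turn_toFree,
    sec_toFree]
  have h1 : edgeTurn (edgeSec s p).rev (edgeTurn s p).rev = p.rev := by revert s p; decide
  have h2 : edgeSec (edgeSec s p).rev (edgeTurn s p).rev = s.rev := by revert s p; decide
  rw [h1, h2, Edge.rev_rev]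

/-- The images of the generators of `GD` acting on the vertices of the horizontal tree. -/
def treeGen : Fin 4 → Equiv.Perm (FreeGroup (Fin 2)) :=
  ![Equiv.mulLeft (FreeGroup.of 0), Equiv.mulLeft (FreeGroup.of 1),
    vertPerm (0, true), vertPerm (1, true)]

lemma treeGen_rels : ∀ r ∈ relsD, FreeGroup.lift treeGen r = 1 := by
  have key {s p p' s' : Edge} (h : edgeTurn s p = p') (h' : edgeSec s p = s') :
      Equiv.mulLeft s.toFree * vertPerm p * (Equiv.mulLeft s'.toFree)⁻¹ * (vertPerm p')⁻¹ = 1 := by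
    rw [mul_inv_eq_one, mul_inv_eq_iff_eq_mul]
    ext f : 1
    exact vertPerm_mul h h' f
  rintro r (rfl | rfl | rfl | rfl)
  · exact key (s := (0, true)) (p := (0, true)) (p' := (1, true)) (s' := (1, true)) rfl rfl
  · exact key (s := (0, true)) (p := (1, true)) (p' := (1, false)) (s' := (1, true)) rfl rfl
  · exact key (s := (1, true)) (p := (0, true)) (p' := (0, true)) (s' := (0, false)) rfl rfl
  · exact key (s := (1, true)) (p := (1, true)) (p' := (0, false)) (s' := (0, true)) rfl rfl

/-- The action of `GD` on the vertices of the horizontal tree. -/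
def treeAction : GD →* Equiv.Perm (FreeGroup (Fin 2)) := PresentedGroup.toGroup treeGen_rels

/-- The generator `x` of `G_D`. -/
def x : GD := PresentedGroup.of 2
/-- The generator `y` of `G_D`. -/
def y : GD := PresentedGroup.of 3

/-- The inclusion of the horizontal free group. -/
def horiz : FreeGroup (Fin 2) →* GD := FreeGroup.lift ![a, b]

/-- The inclusion of the vertical free group. -/
def vert : FreeGroup (Fin 2) →* GD := FreeGroup.lift ![x, y]

lemma treeAction_horiz (f g : FreeGroup (Fin 2)) : treeAction (horiz f) g = f * g := by
  have : treeAction.comp horiz = MulAction.toPermHom (FreeGroup (Fin 2)) (FreeGroup (Fin 2)) := by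
    ext i : 1
    fin_cases i <;>
      simp [horiz, treeAction, a, b, PresentedGroup.toGroup.of, treeGen] <;> rfl
  exact congrArg (fun φ => φ f g) this

lemma treeAction_vert (f : FreeGroup (Fin 2)) : treeAction (vert f) 1 = 1 := by
  suffices vert.range ≤ (MulAction.stabilizer (Equiv.Perm (FreeGroup (Fin 2)))
      (1 : FreeGroup (Fin 2))).comap treeAction from this ⟨f, rfl⟩
  rw [vert, FreeGroup.range_lift_eq_closure, Subgroup.closure_le]
  rintro _ ⟨i, rfl⟩
  have h (r : Edge) : vertPerm r 1 = 1 := by simp [vertPerm, sec_one]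
  fin_cases i <;>
    simp [treeAction, x, y, PresentedGroup.toGroup.of, treeGen, h]

lemma horiz_eq_vert {f g : FreeGroup (Fin 2)} (h : horiz f = vert g) : f = 1 := by
  simpa [h, treeAction_vert] using (treeAction_horiz f 1).symm

/-! ### Relations in `GD` -/

lemma rel_ax : a * x = y * b := by
  have := PresentedGroup.one_of_mem (rels := relsD) (x := _) (Or.inl rfl)
  simp only [map_mul, map_inv] at this
  exact mul_inv_eq_iff_eq_mul.1 (mul_inv_eq_one.1 this)

lemma rel_ay : a * y = y⁻¹ * b := by
  have := PresentedGroup.one_of_mem (rels := relsD) (x := _) (Or.inr (Or.inl rfl))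
  simp only [map_mul, map_inv] at this
  exact mul_inv_eq_iff_eq_mul.1 (eq_inv_of_mul_eq_one_left this)

lemma rel_bx : b * x = x * a⁻¹ := by
  have := PresentedGroup.one_of_mem (rels := relsD) (x := _) (Or.inr (Or.inr (Or.inl rfl)))
  simp only [map_mul, map_inv] at this
  exact eq_mul_inv_of_mul_eq (mul_inv_eq_one.1 this)

lemma rel_by : b * y = x⁻¹ * a := by
  have := PresentedGroup.one_of_mem (rels := relsD) (x := _) (Or.inr (Or.inr (Or.inr rfl)))
  simp only [map_mul, map_inv] at this
  exact mul_inv_eq_iff_eq_mul.1 (eq_inv_of_mul_eq_one_left this)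

lemma horiz_edge_mul_vert_edge (s p : Edge) :
    horiz s.toFree * vert p.toFree =
      vert (edgeTurn s p).toFree * horiz (edgeSec s p).toFree := by
  have flip {s p p' s' : GD} (h : s * p = p' * s') : s⁻¹ * p' = p * s'⁻¹ := by
    rw [inv_mul_eq_iff_eq_mul, ← mul_assoc, h, mul_inv_cancel_right]
  have turn {s p p' s' : GD} (h : s * p = p' * s') : s' * p⁻¹ = p'⁻¹ * s := by
    rw [mul_inv_eq_iff_eq_mul, mul_assoc, h, inv_mul_cancel_left]
  have h1 := rel_ax
  have h2 := rel_ay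
  have h3 := rel_bx
  have h4 := rel_by
  have k1 := turn h1
  have k2 := turn h2
  have k3 := turn h3
  have k4 := turn h4
  have l1 := flip h1
  have l2 := flip h2
  have l3 := flip h3
  have l4 := flip h4
  have m1 := flip k1
  have m2 := flip k2
  have m3 := flip k3
  have m4 := flip k4
  simp only [inv_inv] at *
  obtain ⟨i, _ | _⟩ := s <;> obtain ⟨j, _ | _⟩ := p <;> fin_cases i <;> fin_cases j <;>
    simpa [edgeTurn, edgeSec, Edge.toFree_true, Edge.toFree_false, horiz, vert]

lemma horiz_mul_vert_edge (f : FreeGroup (Fin 2)) (p : Edge) :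
    horiz f * vert p.toFree = vert (turn f p).toFree * horiz (sec f p) := by
  induction f using edge_induction with
  | one => simp [turn_one, sec_one]
  | mul s f ih =>
    rw [map_mul, mul_assoc, ih, ← mul_assoc, horiz_edge_mul_vert_edge, mul_assoc, ← map_mul,
      sec_mul, turn_mul, sec_toFree, turn_toFree]

lemma exists_vert_mul_horiz_edge (g : FreeGroup (Fin 2)) (s : Edge) :
    ∃ (t : Edge) (g' : FreeGroup (Fin 2)),
      vert g * horiz s.toFree = horiz t.toFree * vert g' := by
  induction g using edge_induction with
  | one => exact ⟨s, 1, by simp⟩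
  | mul p g ih =>
    obtain ⟨t, g', h⟩ := ih
    obtain ⟨r, q, h1, h2⟩ : ∃ r q, edgeTurn r q = p ∧ edgeSec r q = t := by
      clear h
      revert p t
      decide
    refine ⟨r, q.toFree * g', ?_⟩
    rw [map_mul, mul_assoc, h, ← mul_assoc, ← h1, ← h2, ← horiz_edge_mul_vert_edge, mul_assoc,
      ← map_mul]

lemma x_ne_y : x ≠ y ∧ x ≠ y⁻¹ := by
  let gen : Fin 4 → Multiplicative (ZMod 6) :=
    ![.ofAdd 1, .ofAdd 5, .ofAdd 0, .ofAdd 2]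
  have hgen : ∀ r ∈ relsD, FreeGroup.lift gen r = 1 := by
    rintro r (rfl | rfl | rfl | rfl) <;> simp [gen] <;> decide
  let φ : GD →* Multiplicative (ZMod 6) := PresentedGroup.toGroup hgen
  have hx : φ x = .ofAdd 0 := PresentedGroup.toGroup.of hgen
  have hy : φ y = .ofAdd 2 := PresentedGroup.toGroup.of hgen
  constructor <;> intro h <;> have := congrArg φ h <;> simp only [map_inv, hx, hy] at this <;>
    revert this <;> decide

/-! ### Irreducibility of the square complex -/

/-- The exponent sum modulo `3`. -/
def expSum : FreeGroup (Fin 2) →* Multiplicative (ZMod 3) :=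
  FreeGroup.lift fun _ => .ofAdd 1

/-- The exponent sum modulo `3`, additively. -/
def weight (f : FreeGroup (Fin 2)) : ZMod 3 := (expSum f).toAdd

/-- The exponent of an oriented edge modulo `3`. -/
def edgeWeight (s : Edge) : ZMod 3 := if s.2 then 1 else -1

lemma weight_mul (f g : FreeGroup (Fin 2)) : weight (f * g) = weight f + weight g := by
  simp [weight]

lemma weight_one : weight 1 = 0 := by simp [weight]

lemma weight_toFree (s : Edge) : weight s.toFree = edgeWeight s := by
  obtain ⟨i, _ | _⟩ := s <;>
    simp [weight, Edge.toFree_true, Edge.toFree_false, expSum, edgeWeight]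

/-- The total weight of the sections of `f` at the vertical edges other than `q`. -/
def secWeight (f : FreeGroup (Fin 2)) (q : Edge) : ZMod 3 :=
  ∑ p ∈ Finset.univ.erase q, weight (sec f p)

lemma sum_erase_turn (φ : Edge → ZMod 3) (g : FreeGroup (Fin 2)) (q : Edge) :
    ∑ p ∈ Finset.univ.erase q, φ (turn g p) = ∑ p ∈ Finset.univ.erase (turn g q), φ p := by
  rw [Finset.sum_erase_eq_sub (Finset.mem_univ _), Finset.sum_erase_eq_sub (Finset.mem_univ _),
    (turn_bijective g).sum_comp]

lemma secWeight_mul (f g : FreeGroup (Fin 2)) (q : Edge) :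
    secWeight (f * g) q = secWeight f (turn g q) + secWeight g q := by
  simp only [secWeight, sec_mul, weight_mul, Finset.sum_add_distrib]
  rw [sum_erase_turn (fun p => weight (sec f p))]

lemma secWeight_one (q : Edge) : secWeight 1 q = 0 := by
  simp [secWeight, sec_one, weight_one]

lemma secWeight_toFree (s q : Edge) :
    secWeight s.toFree q = ∑ p ∈ Finset.univ.erase q, edgeWeight (edgeSec s p) := by
  simp only [secWeight, sec_toFree, weight_toFree]

lemma sum_secWeight_sec (f : FreeGroup (Fin 2)) (q : Edge) :
    ∑ p ∈ Finset.univ.erase q, secWeight (sec f p) p.rev = 2 * secWeight f q := by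
  induction f using edge_induction with
  | one => simp [sec_one, secWeight_one]
  | mul s f ih =>
    simp only [sec_mul, secWeight_mul, turn_sec_rev, Finset.sum_add_distrib, ih, mul_add]
    rw [sum_erase_turn (fun p => secWeight (sec s.toFree p) p.rev)]
    congr 1
    simp only [sec_toFree, secWeight_toFree]
    generalize turn f q = r
    revert s r
    decide

/-- The affine structure on the four vertical edges: every `f` acts as the rotation of
order `3` fixing `x⁻¹`, raised to the weight of `f`, followed by an element of the Klein group. -/
lemma exists_turn_eq (f : FreeGroup (Fin 2)) :
    ∃ (i : Fin 2) (e : Bool), ∀ p, turn f p =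
      (((edgeTurn (0, true))^[(weight f).val] p).1 + i,
        xor ((edgeTurn (0, true))^[(weight f).val] p).2 e) := by
  induction f using edge_induction with
  | one => exact ⟨0, false, fun p => by simp [turn_one, weight_one]⟩
  | mul s f ih =>
    obtain ⟨i, e, h⟩ := ih
    simp only [turn_mul, h, weight_mul, weight_toFree, turn_toFree]
    generalize weight f = u
    clear h
    revert s u i e
    decide

lemma turn_of_weight_ne_zero {f : FreeGroup (Fin 2)} (h : turn f (0, false) = (0, false))
    (hf : weight f ≠ 0) :
    (turn f (0, true) = (1, true) ∧ turn f (1, true) = (1, false) ∧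
      turn f (1, false) = (0, true)) ∨
    (turn f (0, true) = (1, false) ∧ turn f (1, false) = (1, true) ∧
      turn f (1, true) = (0, true)) := by
  obtain ⟨i, e, hp⟩ := exists_turn_eq f
  simp only [hp] at h ⊢
  generalize weight f = u at *
  clear hp
  revert u i e
  decide

/-- `f` fixes `x⁻¹` and acts spherically transitively on the vertical half-tree of words that
do not start with `x⁻¹`. -/
structure IsOdometer (f : FreeGroup (Fin 2)) : Prop where
  turn_eq : turn f (0, false) = (0, false)
  weight_ne_zero : weight f ≠ 0
  secWeight_ne_zero : secWeight f (0, false) ≠ 0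

lemma IsOdometer.turn_ne {f : FreeGroup (Fin 2)} (h : IsOdometer f) :
    turn f (0, true) = (1, true) ∨ turn f (0, true) = (1, false) :=
  (turn_of_weight_ne_zero h.turn_eq h.weight_ne_zero).imp And.left And.left

lemma IsOdometer.turn_cube {f : FreeGroup (Fin 2)} (h : IsOdometer f) :
    turn (f ^ 3) (0, true) = (0, true) := by
  simp only [pow_succ, pow_zero, one_mul, turn_mul]
  rcases turn_of_weight_ne_zero h.turn_eq h.weight_ne_zero with ⟨h1, h2, h3⟩ | ⟨h1, h2, h3⟩ <;>
    simp [h1, h2, h3]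

lemma IsOdometer.sum_orbit {f : FreeGroup (Fin 2)} (h : IsOdometer f) (φ : Edge → ZMod 3) :
    φ (turn f (turn f (0, true))) + φ (turn f (0, true)) + φ (0, true) =
      ∑ p ∈ Finset.univ.erase (0, false), φ p := by
  have : (Finset.univ.erase (0, false) : Finset Edge) = {(0, true), (1, true), (1, false)} := by
    decide
  rw [this]
  rcases turn_of_weight_ne_zero h.turn_eq h.weight_ne_zero with ⟨h1, h2, h3⟩ | ⟨h1, h2, h3⟩ <;>
    simp [h1, h2] <;> ring

lemma IsOdometer.sec_cube {f : FreeGroup (Fin 2)} (h : IsOdometer f) :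
    IsOdometer (sec (f ^ 3) (0, true)) := by
  have hrev : Edge.rev (0, true) = (0, false) := rfl
  have hsec : sec (f ^ 3) (0, true) =
      sec f (turn f (turn f (0, true))) * sec f (turn f (0, true)) * sec f (0, true) := by
    simp only [pow_succ, pow_zero, one_mul, sec_mul, turn_mul, mul_assoc]
  have h1 : weight (sec (f ^ 3) (0, true)) = secWeight f (0, false) := by
    rw [hsec, weight_mul, weight_mul, h.sum_orbit (fun p => weight (sec f p)), secWeight]
  have h2 : secWeight (sec (f ^ 3) (0, true)) (0, false) = 2 * secWeight f (0, false) := by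
    rw [← sum_secWeight_sec, ← h.sum_orbit (fun p => secWeight (sec f p) p.rev), hsec,
      secWeight_mul, secWeight_mul]
    simp only [← hrev, turn_sec_rev]
  refine ⟨?_, h1 ▸ h.secWeight_ne_zero, ?_⟩
  · rw [← hrev, turn_sec_rev, h.turn_cube]
  · have := h.secWeight_ne_zero
    rw [h2]
    clear h1 h2
    generalize secWeight f (0, false) = u at *
    revert u
    decide

/-- The word `b a b a b`. -/
def odometer : FreeGroup (Fin 2) :=
  Edge.toFree (1, true) * (Edge.toFree (0, true) * (Edge.toFree (1, true) *
    (Edge.toFree (0, true) * Edge.toFree (1, true))))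

lemma isOdometer_odometer : IsOdometer odometer := by
  constructor
  · simp only [odometer, turn_mul, turn_toFree]
    decide
  · simp only [odometer, weight_mul, weight_toFree]
    decide
  · simp only [odometer, secWeight_mul, turn_mul, turn_toFree, secWeight_toFree]
    decide

lemma IsOdometer.horiz_cube_mul_x {f : FreeGroup (Fin 2)} (h : IsOdometer f) :
    horiz f ^ 3 * x = x * horiz (sec (f ^ 3) (0, true)) := by
  have := horiz_mul_vert_edge (f ^ 3) (0, true)
  rw [h.turn_cube] at this
  simpa [Edge.toFree_true, vert] using this

lemma exists_isOdometer (n : ℕ) :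
    ∃ f, IsOdometer f ∧ horiz odometer ^ 3 ^ n * x ^ n = x ^ n * horiz f := by
  induction n with
  | zero => exact ⟨odometer, isOdometer_odometer, by simp⟩
  | succ n ih =>
    obtain ⟨f, hf, h⟩ := ih
    refine ⟨_, hf.sec_cube, ?_⟩
    have h3 : SemiconjBy (x ^ n) (horiz f) (horiz odometer ^ 3 ^ n) := h.symm
    rw [pow_succ 3, pow_mul, pow_succ x, ← mul_assoc, ← (h3.pow_right 3).eq, mul_assoc,
      hf.horiz_cube_mul_x, mul_assoc]

/-- No nontrivial power of `x` has all its horizontal conjugates vertical. -/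
lemma exists_horiz_conj_notMem_range_vert {n : ℕ} (hn : n ≠ 0) :
    ∃ f, horiz f * x ^ n * (horiz f)⁻¹ ∉ vert.range := by
  refine ⟨odometer ^ 3 ^ n, ?_⟩
  rintro ⟨g, hg⟩
  obtain ⟨f, hf, h⟩ := exists_isOdometer n
  rw [map_pow, h] at hg
  have hx : vert (FreeGroup.of 0) = x := by simp [vert]
  have hy : vert (FreeGroup.of 1) = y := by simp [vert]
  have hfo : f = odometer ^ 3 ^ n := by
    refine mul_inv_eq_one.1 (horiz_eq_vert (g := (FreeGroup.of 0 ^ n)⁻¹ * g) ?_)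
    rw [map_mul vert, hg, map_inv, map_pow, hx, map_mul, map_inv, map_pow]
    group
  have hfix : ∃ k, horiz f * x = x * horiz k := by
    obtain ⟨m, rfl⟩ := Nat.exists_eq_succ_of_ne_zero hn
    refine ⟨(sec (odometer ^ 3) (0, true)) ^ 3 ^ m, ?_⟩
    have h3 : SemiconjBy x (horiz (sec (odometer ^ 3) (0, true))) (horiz odometer ^ 3) :=
      isOdometer_odometer.horiz_cube_mul_x.symm
    rw [hfo, map_pow, map_pow, Nat.succ_eq_add_one, pow_succ' 3, pow_mul, (h3.pow_right _).eq]
  obtain ⟨k, hk⟩ := hfix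
  have hmove := horiz_mul_vert_edge f (0, true)
  rw [Edge.toFree_true, hx, hk] at hmove
  have key (q : FreeGroup (Fin 2)) (hq : x * horiz k = vert q * horiz (sec f (0, true))) :
      x = vert q := by
    have : horiz (sec f (0, true) * k⁻¹) = vert (q⁻¹ * FreeGroup.of 0) := by
      rw [map_mul, map_mul, map_inv, map_inv, hx, eq_inv_mul_iff_mul_eq, ← mul_assoc, ← hq,
        mul_inv_cancel_right]
    have h1 := mul_inv_eq_one.1 (horiz_eq_vert this)
    rw [h1] at hq
    exact mul_right_cancel hq
  rcases hf.turn_ne with h1 | h1 <;> rw [h1] at hmove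
  · exact x_ne_y.1 (by simpa [Edge.toFree_true, hy] using key _ hmove)
  · exact x_ne_y.2 (by simpa [Edge.toFree_false, hy] using key _ hmove)

/-! ### Finite quotients -/

/-- The cube of a horizontal edge. -/
def cube (s : Edge) : GD := horiz s.toFree ^ 3

lemma cube_false (i : Fin 2) : cube (i, false) = (cube (i, true))⁻¹ := by
  simp [cube, Edge.toFree_false, Edge.toFree_true]

lemma cube_mul_vert_edge (s p : Edge) :
    cube s * vert p.toFree = vert p.toFree * cube (edgeSec s p) := by
  have h1 : edgeTurn s (edgeTurn s (edgeTurn s p)) = p := by revert s p; decide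
  have h2 : ∀ q, edgeSec s (edgeTurn s q) = edgeSec s q := by clear h1; revert s; decide
  have h (q : Edge) : horiz s.toFree * vert q.toFree =
    vert (edgeTurn s q).toFree * horiz (edgeSec s q).toFree := horiz_edge_mul_vert_edge s q
  simp only [cube, pow_succ, pow_zero, one_mul]
  rw [mul_assoc, h, mul_assoc, ← mul_assoc (horiz s.toFree) (vert _), h, mul_assoc, ← mul_assoc, h,
    h1, h2, h2, mul_assoc, mul_assoc]

lemma exists_cube_mul_vert (s : Edge) (g : FreeGroup (Fin 2)) :
    ∃ s', cube s * vert g = vert g * cube s' := by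
  induction g using edge_induction generalizing s with
  | one => exact ⟨s, by simp⟩
  | mul p g ih =>
    obtain ⟨s', h⟩ := ih (edgeSec s p)
    exact ⟨s', by rw [map_mul, ← mul_assoc, cube_mul_vert_edge, mul_assoc, h, mul_assoc]⟩

lemma commute_cube_horiz_edge {s t : Edge} (h : s.1 = t.1) :
    Commute (cube s) (horiz t.toFree) := by
  obtain ⟨i, d⟩ := s
  obtain ⟨j, e⟩ := t
  obtain rfl : i = j := h
  have (d : Bool) : Commute (horiz (Edge.toFree (i, d))) (horiz (Edge.toFree (i, true))) := by
    cases d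
    · simp only [Edge.toFree_false, Edge.toFree_true, map_inv]
      exact (Commute.refl _).inv_left
    · exact Commute.refl _
  cases e
  · rw [Edge.toFree_false, ← Edge.toFree_true, map_inv]
    exact ((this d).pow_left 3).inv_right
  · exact (this d).pow_left 3

section Quotient

variable {Q : Type*} [Group Q] (φ : GD →* Q)

lemma map_cube_mul_x (s : Edge) :
    φ (cube s) * φ x = φ x * φ (cube (edgeSec s (0, true))) := by
  have := congrArg φ (cube_mul_vert_edge s (0, true))
  simpa [Edge.toFree_true, vert] using this

lemma semiconjBy_map_x : SemiconjBy (φ x) (φ a)⁻¹ (φ b) := by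
  have h : SemiconjBy x a⁻¹ b := rel_bx.symm
  simpa using h.map φ

lemma sq_eq_one_of_cube_eq {d e : Bool} (h : φ (cube (0, d)) = φ (cube (1, e))) :
    φ (cube (0, true)) ^ 2 = 1 := by
  have h0 := map_cube_mul_x φ (0, d)
  have h1 := map_cube_mul_x φ (1, e)
  rw [h] at h0
  have h2 := mul_left_cancel (h0.symm.trans h1)
  have h3 : ∀ d, edgeSec (0, d) (0, true) = (1, d) := by decide
  have h4 : ∀ e, edgeSec (1, e) (0, true) = (0, !e) := by decide
  rw [h3, h4] at h2
  rw [sq, mul_eq_one_iff_eq_inv]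
  clear h0 h1 h3 h4
  cases d <;> cases e <;>
    simp only [cube_false, map_inv, inv_inj, Bool.not_true, Bool.not_false] at h h2 ⊢
  · rw [h] at h2 ⊢
    exact h2.symm
  · exact (h.trans h2).symm
  · rwa [h2] at h
  · exact h.trans h2

/-- If `α x = z β` and `β x = x α⁻¹`, where `x` and `z` conjugate the pair `(A, B)` to
`(B, A⁻¹)` and `(B, A)`, then `β` can neither centralize nor invert `A` unless `A² = 1`. -/
lemma sq_eq_one_of_conj {A B x z α β : Q} (hA : A * x = x * B) (hB : B * x = x * A⁻¹)
    (hz : B * z = z * A) (h1 : α * x = z * β) (h2 : β * x = x * α⁻¹)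
    (h : A * β = β * A ∨ A * β = β * A⁻¹) : A ^ 2 = 1 := by
  have hα : α = x⁻¹ * β⁻¹ * x := by
    rw [← inv_inj, ← mul_right_inj x, ← h2]; group
  have hB' : B = x⁻¹ * A * x := by rw [mul_assoc, hA, inv_mul_cancel_left]
  have hαB : B * (α * x) = α * x * (β⁻¹ * A * β) := by
    rw [h1, ← mul_assoc, hz]; group
  rw [sq, mul_eq_one_iff_eq_inv]
  rcases h with h | h
  · have hc : B * α = α * B := by
      have h' : A * β⁻¹ = β⁻¹ * A := (Commute.inv_right h).eq
      rw [hα, hB']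
      calc x⁻¹ * A * x * (x⁻¹ * β⁻¹ * x) = x⁻¹ * (A * β⁻¹) * x := by group
        _ = _ := by rw [h']; group
    rw [← mul_assoc, hc, mul_assoc, hB, mul_assoc, mul_left_cancel_iff, mul_left_cancel_iff,
      mul_assoc, h, inv_mul_cancel_left] at hαB
    exact hαB.symm
  · have hc : B * α = α * B⁻¹ := by
      have h' : A * β⁻¹ = β⁻¹ * A⁻¹ := by
        have : SemiconjBy β A⁻¹ A := h.symm
        simpa using this.inv_symm_left.inv_right.eq.symm
      rw [hα, hB']
      calc x⁻¹ * A * x * (x⁻¹ * β⁻¹ * x) = x⁻¹ * (A * β⁻¹) * x := by group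
        _ = _ := by rw [h']; group
    have hB2 : B⁻¹ * x = x * A := by
      rw [inv_mul_eq_iff_eq_mul, ← mul_assoc, hB, inv_mul_cancel_right]
    rw [← mul_assoc, hc, mul_assoc, hB2, mul_assoc, mul_left_cancel_iff, mul_left_cancel_iff,
      mul_assoc, h, inv_mul_cancel_left] at hαB
    exact hαB

lemma sq_eq_one_of_cube_mul_pow {n : ℕ} (hn : n = 1 ∨ n = 2) {e : Bool} {u : Edge}
    (h : φ (cube (0, true)) * φ (horiz (Edge.toFree (1, e))) ^ n =
      φ (horiz (Edge.toFree (1, e))) ^ n * φ (cube u)) :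
    φ (cube (0, true)) ^ 2 = 1 := by
  obtain ⟨i, d⟩ := u
  obtain rfl | rfl : i = 1 ∨ i = 0 := by clear h; revert i; decide
  · have hc : Commute (φ (cube (1, d))) (φ (horiz (Edge.toFree (1, e))) ^ n) :=
      ((commute_cube_horiz_edge (s := (1, d)) (t := (1, e)) rfl).map φ).pow_right n
    rw [← hc.eq] at h
    exact sq_eq_one_of_cube_eq φ (mul_right_cancel h)
  have hA : cube (0, true) = a ^ 3 := by simp [cube, horiz, Edge.toFree_true]
  have hB : cube (1, true) = b ^ 3 := by simp [cube, horiz, Edge.toFree_true]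
  have hb : horiz (FreeGroup.of 1) = b := by simp [horiz]
  have hAx := map_cube_mul_x φ (0, true)
  have hBx := map_cube_mul_x φ (1, true)
  have hBy := congrArg φ (cube_mul_vert_edge (1, true) (1, true))
  have hBY := congrArg φ (cube_mul_vert_edge (1, true) (1, false))
  have s1 : edgeSec (0, true) (0, true) = (1, true) := rfl
  have s2 : edgeSec (1, true) (0, true) = (0, false) := rfl
  have s3 : edgeSec (1, true) (1, true) = (0, true) := rfl
  have s4 : edgeSec (1, true) (1, false) = (0, true) := rfl
  rw [s1] at hAx
  rw [s2, cube_false, map_inv] at hBx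
  rw [s3, map_mul, map_mul] at hBy
  rw [s4, map_mul, map_mul] at hBY
  have hβ : φ (cube (0, true)) * φ b ^ n = φ b ^ n * φ (cube (0, true)) ∨
      φ (cube (0, true)) * φ b ^ n = φ b ^ n * (φ (cube (0, true)))⁻¹ := by
    have hd : φ (cube (0, d)) = φ (cube (0, true)) ∨ φ (cube (0, d)) = (φ (cube (0, true)))⁻¹ := by
      cases d
      · right; rw [cube_false, map_inv]
      · left; rfl
    have flip {A' B' : Q} (h : A' * (φ b ^ n)⁻¹ = (φ b ^ n)⁻¹ * B') :
        φ b ^ n * A' = B' * φ b ^ n := by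
      rw [mul_inv_eq_iff_eq_mul, mul_assoc] at h
      rw [h, mul_inv_cancel_left]
    cases e
    · rw [Edge.toFree_false, map_inv, map_inv, hb, inv_pow] at h
      have h' := flip h
      rcases hd with hd | hd <;> rw [hd] at h'
      · exact Or.inl h'.symm
      · right
        rw [eq_mul_inv_iff_mul_eq, mul_assoc, h', mul_inv_cancel_left]
    · rw [Edge.toFree_true, hb] at h
      rcases hd with hd | hd <;> rw [hd] at h
      · exact Or.inl h
      · exact Or.inr h
  have hbx := semiconjBy_map_x φ
  rcases hn with rfl | rfl
  · refine sq_eq_one_of_conj (α := φ a ^ 1) hAx hBx hBy ?_ ?_ hβ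
    · simpa [Edge.toFree_true, vert] using congrArg φ rel_ax
    · rw [← inv_pow, (hbx.pow_right 1).eq]
  · refine sq_eq_one_of_conj (α := φ a ^ 2) hAx hBx hBY ?_ ?_ hβ
    · have : a ^ 2 * x = y⁻¹ * b ^ 2 := by
        rw [sq, mul_assoc, rel_ax, ← mul_assoc, rel_ay, mul_assoc, sq]
      simpa [Edge.toFree_false, vert] using congrArg φ this
    · rw [← inv_pow, (hbx.pow_right 2).eq]

lemma sq_eq_one_of_ne {s t : Edge} (hst : s ≠ t) {g : FreeGroup (Fin 2)}
    (h : (φ (horiz t.toFree))⁻¹ * φ (horiz s.toFree) = φ (vert g)) :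
    φ (cube (0, true)) ^ 2 = 1 := by
  have hg (u : Edge) : ∃ u', φ (cube u) * ((φ (horiz t.toFree))⁻¹ * φ (horiz s.toFree)) =
      (φ (horiz t.toFree))⁻¹ * φ (horiz s.toFree) * φ (cube u') := by
    obtain ⟨u', hu⟩ := exists_cube_mul_vert u g
    exact ⟨u', by rw [h, ← map_mul, hu, map_mul]⟩
  have hg' (u : Edge) : ∃ u', φ (cube u) * ((φ (horiz s.toFree))⁻¹ * φ (horiz t.toFree)) =
      (φ (horiz s.toFree))⁻¹ * φ (horiz t.toFree) * φ (cube u') := by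
    obtain ⟨u', hu⟩ := exists_cube_mul_vert u g⁻¹
    have h' : (φ (horiz s.toFree))⁻¹ * φ (horiz t.toFree) = φ (vert g⁻¹) := by
      rw [map_inv, map_inv, ← h]; group
    exact ⟨u', by rw [h', ← map_mul, hu, map_mul]⟩
  have mixed {d e : Bool} (hm : ∃ u', φ (cube (0, true)) *
      ((φ (horiz (Edge.toFree (0, d))))⁻¹ * φ (horiz (Edge.toFree (1, e)))) =
      (φ (horiz (Edge.toFree (0, d))))⁻¹ * φ (horiz (Edge.toFree (1, e))) * φ (cube u')) :
      φ (cube (0, true)) ^ 2 = 1 := by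
    obtain ⟨u', hu⟩ := hm
    have hc : Commute (φ (cube (0, true))) (φ (horiz (Edge.toFree (0, d))))⁻¹ :=
      ((commute_cube_horiz_edge (s := (0, true)) (t := (0, d)) rfl).map φ).inv_right
    rw [← mul_assoc, hc.eq, mul_assoc, mul_assoc, mul_left_cancel_iff] at hu
    exact sq_eq_one_of_cube_mul_pow φ (n := 1) (.inl rfl) (by simpa using hu)
  have fin_two : ∀ i : Fin 2, i = 0 ∨ i = 1 := by decide
  obtain ⟨i, d⟩ := s
  obtain ⟨j, e⟩ := t
  have inv_e (k : Fin 2) (he : d ≠ e) : (φ (horiz (Edge.toFree (k, e))))⁻¹ =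
      φ (horiz (Edge.toFree (k, d))) := by
    cases d <;> cases e <;> simp_all [Edge.toFree_true, Edge.toFree_false]
  rcases fin_two i with rfl | rfl <;> rcases fin_two j with rfl | rfl
  · obtain ⟨u', hu⟩ := hg (1, true)
    rw [inv_e 0 (by rintro rfl; exact hst rfl), ← sq] at hu
    have hx : SemiconjBy (φ x) (φ (horiz (Edge.toFree (0, d))))
        (φ (horiz (Edge.toFree (1, !d)))) := by
      have := semiconjBy_map_x φ
      cases d
      · simpa [Edge.toFree_true, Edge.toFree_false, horiz] using this
      · simpa [Edge.toFree_true, Edge.toFree_false, horiz] using this.inv_right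
    obtain ⟨u'', hu''⟩ := exists_cube_mul_vert u' (Edge.toFree (0, false))
    have hvx : vert (Edge.toFree (0, false)) = x⁻¹ := by simp [vert, Edge.toFree_false]
    have hxu : SemiconjBy (φ x) (φ (cube u')) (φ (cube u'')) := by
      refine SemiconjBy.map ?_ φ
      rw [hvx, mul_inv_eq_iff_eq_mul, mul_assoc] at hu''
      rw [SemiconjBy, hu'', mul_inv_cancel_left]
    have hxB : SemiconjBy (φ x) (φ (cube (1, true))) (φ (cube (0, true))) :=
      (map_cube_mul_x φ (0, true)).symm
    have h1 := hxB.mul_right (hx.pow_right 2)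
    have h2 := (hx.pow_right 2).mul_right hxu
    rw [hu] at h1
    exact sq_eq_one_of_cube_mul_pow φ (.inr rfl) (mul_right_cancel (h1.eq.symm.trans h2.eq))
  · exact mixed (hg' _)
  · exact mixed (hg _)
  · obtain ⟨u', hu⟩ := hg (0, true)
    rw [inv_e 1 (by rintro rfl; exact hst rfl), ← sq] at hu
    exact sq_eq_one_of_cube_mul_pow φ (.inr rfl) hu

end Quotient

/-- If `a ^ 6` is not in the normal subgroup `H`, then conjugation by horizontal elements
preserves the vertical elements of `H`. -/
lemma horiz_conj_mem_range_vert {H : Subgroup GD} [H.Normal] (ha : a ^ 6 ∉ H)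
    (f g : FreeGroup (Fin 2)) (hg : vert g ∈ H) :
    horiz f * vert g * (horiz f)⁻¹ ∈ vert.range := by
  induction f using edge_induction with
  | one => exact ⟨g, by simp⟩
  | mul s f ih =>
    obtain ⟨k, hk⟩ := ih
    have hkH : vert k ∈ H := hk ▸ Subgroup.Normal.conj_mem ‹_› _ hg _
    obtain ⟨t, k', h⟩ := exists_vert_mul_horiz_edge k s.rev
    have hs : horiz s.toFree * vert k * (horiz s.toFree)⁻¹ =
        horiz s.toFree * horiz t.toFree * vert k' := by
      rw [mul_assoc, ← map_inv, ← Edge.toFree_rev, h, mul_assoc]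
    have hst : s.rev = t := by
      by_contra hne
      refine ha ?_
      have hmem := Subgroup.Normal.conj_mem ‹_› _ hkH (horiz s.toFree)
      rw [hs, ← QuotientGroup.eq_one_iff, QuotientGroup.mk_mul] at hmem
      have h6 := sq_eq_one_of_ne (QuotientGroup.mk' H) (s := s.rev) (t := t) hne (g := k') (by
        rw [Edge.toFree_rev, map_inv, map_inv, ← mul_inv_rev, ← map_mul]
        exact (eq_inv_of_mul_eq_one_right hmem).symm)
      rw [← QuotientGroup.eq_one_iff]
      simpa [cube, horiz, Edge.toFree_true, ← pow_mul] using h6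
    refine ⟨k', ?_⟩
    calc vert k' = horiz s.toFree * vert k * (horiz s.toFree)⁻¹ := by
          rw [hs, ← hst, Edge.toFree_rev, map_inv, mul_inv_cancel, one_mul]
      _ = _ := by rw [hk, map_mul]; group

lemma a_pow_six_mem (H : Subgroup GD) [H.Normal] [H.FiniteIndex] : a ^ 6 ∈ H := by
  by_contra ha
  obtain ⟨n, hn, -, hx⟩ := Subgroup.exists_pow_mem_of_index_ne_zero
    (Subgroup.FiniteIndex.index_ne_zero (H := H)) x
  obtain ⟨f, hf⟩ := exists_horiz_conj_notMem_range_vert hn.ne'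
  have hv : vert (FreeGroup.of 0 ^ n) = x ^ n := by simp [vert]
  rw [← hv] at hx hf
  exact hf (horiz_conj_mem_range_vert ha f _ hx)

lemma b_pow_six : b ^ 6 = x * (a ^ 6)⁻¹ * x⁻¹ := by
  have : b = x * a⁻¹ * x⁻¹ := eq_mul_inv_of_mul_eq rel_bx
  rw [this, conj_pow, inv_pow]

lemma a_pow_six_ne_one : a ^ 6 ≠ 1 := by
  intro h
  have h1 : horiz (FreeGroup.of 0 ^ 6) = vert 1 := by simpa [horiz] using h
  have h2 := congrArg FreeGroup.norm (horiz_eq_vert h1)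
  simp at h2

end JanzenWise

open JanzenWise in
/-- The elements `a⁶` and `b⁶` of `G_D` are nontrivial and lie in every finite-index
subgroup; in particular `G_D` is not residually finite. -/
theorem GD_not_residuallyFinite :
    a ^ 6 ≠ 1 ∧ b ^ 6 ≠ 1 ∧
    (∀ H : Subgroup GD, H.FiniteIndex → a ^ 6 ∈ H ∧ b ^ 6 ∈ H) ∧
    ¬ (∀ g : GD, g ≠ 1 → ∃ N : Subgroup GD, N.Normal ∧ N.FiniteIndex ∧ g ∉ N) := by
  refine ⟨a_pow_six_ne_one, ?_, fun H _ => ?_, fun h => ?_⟩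
  · rw [b_pow_six, Ne, conj_eq_one_iff, inv_eq_one]
    exact a_pow_six_ne_one
  · have ha : a ^ 6 ∈ H.normalCore := a_pow_six_mem _
    refine ⟨H.normalCore_le ha, H.normalCore_le ?_⟩
    rw [b_pow_six]
    exact Subgroup.Normal.conj_mem inferInstance _ (inv_mem ha) _
  · obtain ⟨N, hN, hfin, ha⟩ := h _ a_pow_six_ne_one
    exact ha (a_pow_six_mem N)
end

section
/- Consider the bireversible automaton A_D with state set S = {a, b, A, B} (A, B standing for a⁻¹, b⁻¹) and alphabet X = {x, y, X', Y'} (X', Y' standing for x⁻¹, y⁻¹), with transitions λ(s, input) = (output, next state) given by: from a: x↦(y,b), y↦(Y',b), Y'↦(x,b), X'↦(X',B); from b: x↦(x,A), y↦(X',a), X'↦(Y',a), Y'↦(y,a); from A: x↦(Y',B), y↦(x,B), Y'↦(y,B), X'↦(X',b); from B: x↦(x,a), y↦(Y',A), Y'↦(X',A), X'↦(y,A). Let α = σ_a and β = σ_b be the permutations of List X defined by the states a and b. Then: (1) α³ = 1 and β³ = 1, and the induced homomorphism from the free product (ZMod 3) * (ZMod 3) to Perm(List X) sending the two canonical generators to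 α and β is injective; hence the automaton group G_{A_D} is isomorphic to C₃ * C₃. (2) Letting ξ = τ_x and η = τ_y be the permutations of List S defined by the letters x and y of the dual automaton, the homomorphism FreeGroup (Fin 2) →* Perm(List S) sending the two free generators to ξ and η is injective; hence the dual automaton group G_{∂A_D} is a free group of rank 2. -/
/-- A Mealy automaton with state set `S` and alphabet `X`:
`λ(s,x) = (o s x, t s x)`. -/
structure Mealy (S X : Type) where
  o : S → X → X
  t : S → X → S

namespace Mealy

variable {S X : Type}

/-- Bireversibility of a Mealy automaton. -/
def Bireversible (M : Mealy S X) : Prop :=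
  (∀ s, Function.Bijective (M.o s)) ∧
  (∀ x, Function.Bijective (fun s => M.t s x)) ∧
  Function.Bijective (fun p : S × X => (M.o p.1 p.2, M.t p.1 p.2))

/-- The action of a state on words over the alphabet. -/
def actWord (M : Mealy S X) : S → List X → List X
  | _, [] => []
  | s, x :: w => M.o s x :: M.actWord (M.t s x) w

/-- The dual action of a letter on words over the states. -/
def dualActWord (M : Mealy S X) : X → List S → List S
  | _, [] => []
  | x, s :: w => M.t s x :: M.dualActWord (M.o s x) w

/-- The relators `s x (t s x)⁻¹ (o s x)⁻¹` of the square-complex group. -/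
def rels (M : Mealy S X) : Set (FreeGroup (S ⊕ X)) :=
  ⋃ (s : S) (x : X),
    {FreeGroup.of (Sum.inl s) * FreeGroup.of (Sum.inr x) *
      (FreeGroup.of (Sum.inl (M.t s x)))⁻¹ * (FreeGroup.of (Sum.inr (M.o s x)))⁻¹}

/-- The fundamental group `π₁(Δ_A)` of the square complex of the automaton. -/
abbrev Pi1 (M : Mealy S X) := PresentedGroup M.rels

/-- The image of a state in `π₁(Δ_A)`. -/
def genS (M : Mealy S X) (s : S) : M.Pi1 := PresentedGroup.of (Sum.inl s)

/-- The image of a letter in `π₁(Δ_A)`. -/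
def genX (M : Mealy S X) (x : X) : M.Pi1 := PresentedGroup.of (Sum.inr x)

/-- The subgroup `⟨S⟩` of `π₁(Δ_A)`. -/
def subS (M : Mealy S X) : Subgroup M.Pi1 := Subgroup.closure (Set.range M.genS)

/-- The subgroup `⟨X⟩` of `π₁(Δ_A)`. -/
def subX (M : Mealy S X) : Subgroup M.Pi1 := Subgroup.closure (Set.range M.genX)

/-- The automaton group `G_A`: the subgroup of `Perm (List X)` generated by the
permutations `σ_s` defined by the states. -/
def autGroup (M : Mealy S X) : Subgroup (Equiv.Perm (List X)) :=
  Subgroup.closure {σ : Equiv.Perm (List X) | ∃ s, ⇑σ = M.actWord s}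

/-- The dual automaton group `G_{∂A}`. -/
def dualAutGroup (M : Mealy S X) : Subgroup (Equiv.Perm (List S)) :=
  Subgroup.closure {τ : Equiv.Perm (List S) | ∃ x, ⇑τ = M.dualActWord x}

end Mealy

open Mealy

/-- The bireversible automaton `A_D` associated to the square complex `Δ_D`, with
states `a = 0`, `b = 1`, `a⁻¹ = 2`, `b⁻¹ = 3` and letters
`x = 0`, `y = 1`, `x⁻¹ = 2`, `y⁻¹ = 3`. -/
def AD : Mealy (Fin 4) (Fin 4) where
  o := ![![1, 3, 2, 0], ![0, 2, 3, 1], ![3, 0, 2, 1], ![0, 3, 1, 2]]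
  t := ![![1, 1, 3, 1], ![2, 0, 0, 0], ![3, 3, 1, 3], ![0, 2, 2, 2]]

namespace Mealy

variable {S X : Type}

/-- The dual automaton, in which states and letters exchange their roles. -/
def dual (M : Mealy S X) : Mealy X S where
  o x s := M.t s x
  t x s := M.o s x

theorem dual_actWord (M : Mealy S X) (x : X) (h : List S) :
    M.dual.actWord x h = M.dualActWord x h := by
  induction h generalizing x with
  | nil => rfl
  | cons s h ih => exact congrArg _ (ih _)

theorem actWord_injective {M : Mealy S X} (ho : ∀ s, Function.Injective (M.o s)) (s : S) :
    Function.Injective (M.actWord s) := by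
  intro v
  induction v generalizing s with
  | nil =>
    rintro (_ | ⟨y, w⟩) h
    · rfl
    · simp [actWord] at h
  | cons x v ih =>
    rintro (_ | ⟨y, w⟩) h
    · simp [actWord] at h
    · obtain ⟨h₁, h₂⟩ := List.cons.inj h
      obtain rfl := ho s h₁
      rw [ih _ h₂]

/-- The action of a word of states, the first state acting first. -/
def actList (M : Mealy S X) (h : List S) (w : List X) : List X :=
  h.foldl (fun w s => M.actWord s w) w

/-- The dual action of a word of letters, the first letter acting first. -/
def dualActList (M : Mealy S X) (d : List X) (h : List S) : List S :=
  d.foldl (fun h x => M.dualActWord x h) h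

/-- The state reached from `s` after reading a word. -/
def runState (M : Mealy S X) (s : S) (d : List X) : S :=
  d.foldl M.t s

theorem exists_actList_cons (M : Mealy S X) (h : List S) (x : X) :
    ∃ y, ∀ w, M.actList h (x :: w) = y :: M.actList (M.dualActWord x h) w := by
  induction h generalizing x with
  | nil => exact ⟨x, fun _ => rfl⟩
  | cons s h ih =>
    obtain ⟨y, hy⟩ := ih (M.o s x)
    exact ⟨y, fun w => hy _⟩

theorem dualActList_cons (M : Mealy S X) (d : List X) (s : S) (h : List S) :
    M.dualActList d (s :: h) = M.runState s d :: M.dualActList (M.actWord s d) h := by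
  induction d generalizing s h with
  | nil => rfl
  | cons x d ih => exact ih _ _

theorem dualActList_nil (M : Mealy S X) (d : List X) : M.dualActList d [] = [] := by
  induction d with
  | nil => rfl
  | cons x d ih => exact ih

theorem runState_append (M : Mealy S X) (s : S) (d e : List X) :
    M.runState s (d ++ e) = M.runState (M.runState s d) e :=
  List.foldl_append

theorem actWord_append (M : Mealy S X) (s : S) (d e : List X) :
    M.actWord s (d ++ e) = M.actWord s d ++ M.actWord (M.runState s d) e := by
  induction d generalizing s with
  | nil => rfl
  | cons x d ih => exact congrArg _ (ih _)

theorem runState_power {M : Mealy S X} {s : S} {d : List X} (h : M.runState s d = s) (n : ℕ) :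
    M.runState s (List.replicate n d).flatten = s ∧
      M.actWord s (List.replicate n d).flatten =
        (List.replicate n (M.actWord s d)).flatten := by
  induction n with
  | zero => exact ⟨rfl, rfl⟩
  | succ n ih =>
    simp only [List.replicate_succ, List.flatten_cons, runState_append, actWord_append, h]
    exact ⟨ih.1, congrArg _ ih.2⟩

theorem flatten_replicate_mul (d : List X) (n k : ℕ) :
    (List.replicate (n * k) d).flatten =
      (List.replicate n (List.replicate k d).flatten).flatten := by
  induction n with
  | zero => simp
  | succ n ih =>
    rw [Nat.succ_mul, Nat.add_comm, List.replicate_add, List.flatten_append, ih,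
      List.replicate_succ, List.flatten_cons]

/-- The dual action preserves the words of states that act trivially. -/
theorem actList_dualActList_eq_id {M : Mealy S X} {h : List S} (hh : ∀ w, M.actList h w = w)
    (d : List X) (w : List X) : M.actList (M.dualActList d h) w = w := by
  induction d generalizing h with
  | nil => exact hh w
  | cons x d ih =>
    refine ih fun v => ?_
    obtain ⟨y, hy⟩ := M.exists_actList_cons h x
    exact (List.cons.inj ((hy v).symm.trans (hh _))).2

/-- A tree of words of states that is preserved by the dual action: a context `c` determines the
`p` states `fib c i` that may be read next, reading `fib c i` leads to the context `nxt c i`,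
and a letter `x` moves the context `c` to `mov x c` while rotating its fiber by `F root x c`.
The functions `F j` are closed under summation over sections. -/
structure TreeAction (M : Mealy S X) (p : ℕ) [NeZero p] (C J : Type) where
  fib : C → ZMod p → S
  nxt : C → ZMod p → C
  mov : X → C → C
  F : J → X → C → ZMod p
  root : J
  shift : J → J
  t_fib : ∀ c i x, M.t (fib c i) x = fib (mov x c) (i + F root x c)
  nxt_mov : ∀ c i x, nxt (mov x c) (i + F root x c) = mov (M.o (fib c i) x) (nxt c i)
  sum_F : ∀ j c x, ∑ i, F j (M.o (fib c i) x) (nxt c i) = F (shift j) x c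

namespace TreeAction

variable {M : Mealy S X} {p : ℕ} [NeZero p] {C J : Type} (T : TreeAction M p C J)

/-- The context to which a word of letters moves a context. -/
def movList (d : List X) (c : C) : C :=
  d.foldl (fun c x => T.mov x c) c

/-- The extension of `F` to words of letters as a cocycle. -/
def FList (j : J) : List X → C → ZMod p
  | [], _ => 0
  | x :: d, c => T.F j x c + FList j d (T.mov x c)

/-- The word of states read along a path of the tree. -/
def word : C → List (ZMod p) → List S
  | _, [] => []
  | c, i :: u => T.fib c i :: word (T.nxt c i) u

/-- The context at the end of a path of the tree. -/
def last (c : C) (u : List (ZMod p)) : C :=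
  u.foldl T.nxt c

/-- The word `d` fixes `c` and acts transitively on every level of the tree below `c`, as seen
from the total rotations on the levels. -/
def Transitive (c : C) (d : List X) : Prop :=
  T.movList d c = c ∧ ∀ j, T.FList j d c ≠ 0

theorem word_append (c : C) (u : List (ZMod p)) (i : ZMod p) :
    T.word c (u ++ [i]) = T.word c u ++ [T.fib (T.last c u) i] := by
  induction u generalizing c with
  | nil => rfl
  | cons k u ih => exact congrArg _ (ih _)

theorem movList_append (d e : List X) (c : C) :
    T.movList (d ++ e) c = T.movList e (T.movList d c) :=
  List.foldl_append

theorem FList_append (j : J) (d e : List X) (c : C) :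
    T.FList j (d ++ e) c = T.FList j d c + T.FList j e (T.movList d c) := by
  induction d generalizing c with
  | nil => simp [FList, movList]
  | cons x d ih => simp [FList, ih, movList, add_assoc]

theorem runState_fib (c : C) (i : ZMod p) (d : List X) :
    M.runState (T.fib c i) d = T.fib (T.movList d c) (i + T.FList T.root d c) := by
  induction d generalizing c i with
  | nil => simp [runState, movList, FList]
  | cons x d ih =>
    have := ih (T.mov x c) (i + T.F T.root x c)
    rw [← T.t_fib, add_assoc] at this
    exact this

theorem movList_actWord (c : C) (i : ZMod p) (d : List X) :
    T.movList (M.actWord (T.fib c i) d) (T.nxt c i) =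
      T.nxt (T.movList d c) (i + T.FList T.root d c) := by
  induction d generalizing c i with
  | nil => simp [actWord, movList, FList]
  | cons x d ih =>
    have := ih (T.mov x c) (i + T.F T.root x c)
    rw [← T.t_fib, add_assoc, T.nxt_mov] at this
    exact this

theorem sum_FList (j : J) (c : C) (d : List X) :
    ∑ i, T.FList j (M.actWord (T.fib c i) d) (T.nxt c i) = T.FList (T.shift j) d c := by
  induction d generalizing c with
  | nil => simp [actWord, FList]
  | cons x d ih =>
    simp only [actWord, FList, Finset.sum_add_distrib, T.sum_F, T.t_fib, ← T.nxt_mov]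
    rw [← ih]
    congr 1
    exact Equiv.sum_comp (Equiv.addRight (T.F T.root x c)) fun i =>
      T.FList j (M.actWord (T.fib (T.mov x c) i) d) (T.nxt (T.mov x c) i)

theorem Transitive.power {T : TreeAction M p C J} {c : C} {d : List X} (hd : T.Transitive c d)
    (n : ℕ) (i : ZMod p) :
    M.runState (T.fib c i) (List.replicate n d).flatten =
        T.fib c (i + n * T.FList T.root d c) ∧
      T.movList (M.actWord (T.fib c i) (List.replicate n d).flatten) (T.nxt c i) =
        T.nxt c (i + n * T.FList T.root d c) ∧
      ∀ j, T.FList j (M.actWord (T.fib c i) (List.replicate n d).flatten) (T.nxt c i) =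
        ∑ k ∈ Finset.range n, T.FList j
          (M.actWord (T.fib c (i + k * T.FList T.root d c)) d)
          (T.nxt c (i + k * T.FList T.root d c)) := by
  induction n with
  | zero => simp [runState, actWord, movList, FList]
  | succ n ih =>
    obtain ⟨h₁, h₂, h₃⟩ := ih
    have hn : (List.replicate (n + 1) d).flatten = (List.replicate n d).flatten ++ d := by
      rw [List.replicate_succ', List.flatten_append]
      simp
    have hi : i + (n + 1 : ℕ) * T.FList T.root d c =
        i + n * T.FList T.root d c + T.FList T.root d c := by
      push_cast
      ring
    rw [hn, hi, runState_append, actWord_append, movList_append, h₁, h₂, runState_fib,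
      movList_actWord, hd.1]
    refine ⟨rfl, rfl, fun j => ?_⟩
    rw [FList_append, h₂, h₃, Finset.sum_range_succ]

theorem sum_range_add_mul [Fact p.Prime] (f : ZMod p → ZMod p) (i r : ZMod p) (hr : r ≠ 0) :
    ∑ k ∈ Finset.range p, f (i + k * r) = ∑ k, f k := by
  rw [← Equiv.sum_comp ((Equiv.mulRight₀ r hr).trans (Equiv.addLeft i))]
  refine Finset.sum_bij' (fun k _ => (k : ZMod p)) (fun k _ => k.val) ?_ ?_ ?_ ?_ ?_
  · simp
  · intro k _
    simpa using ZMod.val_lt k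
  · intro k hk
    exact ZMod.val_cast_of_lt (Finset.mem_range.1 hk)
  · simp
  · simp

theorem Transitive.actWord [Fact p.Prime] {T : TreeAction M p C J} {c : C} {d : List X}
    (hd : T.Transitive c d) (i : ZMod p) :
    M.runState (T.fib c i) (List.replicate p d).flatten = T.fib c i ∧
      T.Transitive (T.nxt c i) (M.actWord (T.fib c i) (List.replicate p d).flatten) := by
  obtain ⟨h₁, h₂, h₃⟩ := hd.power p i
  simp only [CharP.cast_eq_zero, zero_mul, add_zero] at h₁ h₂
  refine ⟨h₁, h₂, fun j => ?_⟩
  rw [h₃, sum_range_add_mul (fun k => T.FList j (M.actWord (T.fib c k) d) (T.nxt c k)) _ _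
    (hd.2 T.root), T.sum_FList]
  exact hd.2 _

theorem Transitive.exists_rotation [Fact p.Prime] {T : TreeAction M p C J} {c : C} {d : List X}
    (hd : T.Transitive c d) (u : List (ZMod p)) (i : ZMod p) :
    ∃ n k, k ≠ i ∧
      M.dualActList (List.replicate n d).flatten (T.word c (u ++ [i])) = T.word c (u ++ [k]) := by
  induction u generalizing c d with
  | nil =>
    refine ⟨1, i + T.FList T.root d c, by simpa using hd.2 T.root, ?_⟩
    have h := T.runState_fib c i d
    rw [hd.1] at h
    simp [word, dualActList_cons, h, dualActList_nil]
  | cons l u ih =>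
    obtain ⟨hl, hs⟩ := hd.actWord l
    obtain ⟨n, k, hk, h⟩ := ih hs
    obtain ⟨h₁, h₂⟩ := runState_power hl n
    refine ⟨n * p, k, hk, ?_⟩
    rw [flatten_replicate_mul, List.cons_append, word, dualActList_cons, h₁, h₂, h]
    rfl

/-- If distinct states of a fiber act differently, then a nonempty word of the tree below a
context admitting a transitive word of letters acts nontrivially. -/
theorem Transitive.not_actList_eq_id [Fact p.Prime] {T : TreeAction M p C J} {c : C} {d : List X}
    (hd : T.Transitive c d) (ho : ∀ s, Function.Injective (M.o s))
    (hfib : ∀ c i k, M.actWord (T.fib c i) = M.actWord (T.fib c k) → i = k)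
    {u : List (ZMod p)} (hu : u ≠ []) : ¬ ∀ w, M.actList (T.word c u) w = w := by
  intro h
  obtain ⟨u, i, rfl⟩ : ∃ v i, u = v ++ [i] := ⟨_, _, (List.dropLast_append_getLast hu).symm⟩
  obtain ⟨n, k, hk, hr⟩ := hd.exists_rotation u i
  have h' := actList_dualActList_eq_id h (List.replicate n d).flatten
  rw [hr] at h'
  simp only [word_append, actList, List.foldl_append, List.foldl_cons, List.foldl_nil] at h h'
  refine hk (hfib (T.last c u) k i (funext fun w => ?_))
  have hw := actWord_injective ho _ (h (M.actWord (T.fib (T.last c u) i) w))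
  have hw' := h' (M.actWord (T.fib (T.last c u) i) w)
  rwa [hw] at hw'

/-- The product of a word of states, the first state being the rightmost factor. -/
def evalWord {G : Type} [Group G] (gen : S → G) (h : List S) : G :=
  h.foldr (fun s g => g * gen s) 1

/-- A homomorphism realizing the action of the states is injective as soon as every group element
is represented by a word of the tree. -/
theorem injective_of_transitive [Fact p.Prime] (ho : ∀ s, Function.Injective (M.o s))
    (hfib : ∀ c i k, M.actWord (T.fib c i) = M.actWord (T.fib c k) → i = k)
    (hd : ∀ c, ∃ d, T.Transitive c d) {G : Type} [Group G] (gen : S → G) (inv : S → S)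
    (hinv : ∀ s, gen (inv s) = (gen s)⁻¹) (hgen : Subgroup.closure (Set.range gen) = ⊤) (c₀ : C)
    (hmul : ∀ c u s, ∃ c' u',
      evalWord gen (T.word c u) * gen s = evalWord gen (T.word c' u'))
    (f : G →* Equiv.Perm (List X)) (hf : ∀ s, ⇑(f (gen s)) = M.actWord s) :
    Function.Injective f := by
  have hrep (g : G) : ∃ c u, g = evalWord gen (T.word c u) := by
    have hg : g ∈ Subgroup.closure (Set.range gen) := hgen ▸ Subgroup.mem_top g
    induction hg using Subgroup.closure_induction_right with
    | one => exact ⟨c₀, [], rfl⟩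
    | mul_right x hx y hy ih =>
      obtain ⟨c, u, rfl⟩ := ih
      obtain ⟨s, rfl⟩ := hy
      exact hmul c u s
    | mul_inv_cancel x hx y hy ih =>
      obtain ⟨c, u, rfl⟩ := ih
      obtain ⟨s, rfl⟩ := hy
      rw [← hinv]
      exact hmul c u (inv s)
  have heval (h : List S) : ⇑(f (evalWord gen h)) = M.actList h := by
    induction h with
    | nil => rw [evalWord, List.foldr_nil, map_one]; rfl
    | cons s h ih =>
      have : evalWord gen (s :: h) = evalWord gen h * gen s := rfl
      rw [this, map_mul, Equiv.Perm.coe_mul, ih, hf]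
      rfl
  rw [injective_iff_map_eq_one]
  intro g hg
  obtain ⟨c, u, rfl⟩ := hrep g
  obtain ⟨d, hd⟩ := hd c
  by_cases hu : u = []
  · subst hu
    rfl
  · refine absurd (fun w => ?_) (hd.not_actList_eq_id ho hfib hu)
    rw [← heval, hg, Equiv.Perm.one_apply]

end TreeAction

end Mealy

/-- The inversion of the states and of the letters of `A_D`. -/
def barAD : Fin 4 → Fin 4 := ![2, 3, 0, 1]

theorem AD_actWord_bar (s : Fin 4) (w : List (Fin 4)) :
    AD.actWord (barAD s) (AD.actWord s w) = w := by
  induction w generalizing s with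
  | nil => rfl
  | cons x w ih =>
    have h : AD.o (barAD s) (AD.o s x) = x ∧ AD.t (barAD s) (AD.o s x) = barAD (AD.t s x) := by
      revert s x
      decide
    rw [actWord, actWord, h.1, h.2, ih]

theorem AD_dualActWord_bar (x : Fin 4) (h : List (Fin 4)) :
    AD.dualActWord (barAD x) (AD.dualActWord x h) = h := by
  induction h generalizing x with
  | nil => rfl
  | cons s h ih =>
    have h : AD.t (AD.t s x) (barAD x) = s ∧ AD.o (AD.t s x) (barAD x) = barAD (AD.o s x) := by
      revert s x
      decide
    rw [dualActWord, dualActWord, h.1, h.2, ih]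

theorem AD_actWord_cube (s : Fin 4) (w : List (Fin 4)) :
    AD.actWord s (AD.actWord s (AD.actWord s w)) = w := by
  induction w generalizing s with
  | nil => rfl
  | cons x w ih =>
    have h : AD.o s (AD.o s (AD.o s x)) = x ∧ AD.t s (AD.o s x) = AD.t s x ∧
        AD.t s (AD.o s (AD.o s x)) = AD.t s x := by
      revert s x
      decide
    rw [actWord, actWord, actWord, h.1, h.2.1, h.2.2, ih]

/-- The tree of alternating words of states of `A_D`. A context records which of the pairs
`{a, a⁻¹}` and `{b, b⁻¹}` comes next. -/
def alternatingTree : TreeAction AD 2 (Fin 2) (Fin 2) where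
  fib := ![![0, 2], ![1, 3]]
  nxt c _ := 1 - c
  mov _ c := 1 - c
  F := ![![![0, 1], ![0, 0], ![1, 0], ![0, 0]], ![![0, 0], ![1, 1], ![0, 0], ![1, 1]]]
  root := 0
  shift _ := 1
  t_fib := by decide
  nxt_mov := by decide
  sum_F := by decide

/-- The tree of freely reduced words of letters of `A_D`. A context records the letter that must
not come next. -/
def reducedTree : TreeAction AD.dual 3 (Fin 4) (Fin 3) where
  fib := ![![1, 2, 3], ![0, 3, 2], ![0, 1, 3], ![0, 2, 1]]
  nxt := ![![3, 0, 1], ![2, 1, 0], ![2, 3, 1], ![2, 0, 3]]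
  mov s c := AD.o s c
  F := ![![![1, 2, 1, 0], ![1, 0, 0, 0], ![0, 2, 2, 1], ![2, 0, 0, 0]],
    ![![2, 2, 0, 2], ![0, 2, 1, 0], ![1, 1, 0, 1], ![0, 0, 1, 2]],
    ![![2, 0, 0, 1], ![0, 1, 1, 1], ![2, 1, 0, 0], ![0, 2, 2, 2]]]
  root := 0
  shift := ![1, 2, 1]
  t_fib := by decide
  nxt_mov := by decide
  sum_F := by decide

theorem alternatingTree_transitive (c : Fin 2) : ∃ d, alternatingTree.Transitive c d := by
  refine ⟨![[2, 1], [0, 1]] c, ?_⟩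
  unfold TreeAction.Transitive
  revert c
  decide

theorem reducedTree_transitive (c : Fin 4) : ∃ d, reducedTree.Transitive c d := by
  refine ⟨![[0, 3, 0], [0, 1], [1, 2, 1], [1, 0]] c, ?_⟩
  unfold TreeAction.Transitive
  revert c
  decide

theorem alternatingTree_fib_injective (c : Fin 2) (i k : ZMod 2)
    (h : AD.actWord (alternatingTree.fib c i) = AD.actWord (alternatingTree.fib c k)) : i = k := by
  have h' := congrFun h [1]
  clear h
  revert c i k
  decide

theorem reducedTree_fib_injective (c : Fin 4) (i k : ZMod 3)
    (h : AD.dual.actWord (reducedTree.fib c i) = AD.dual.actWord (reducedTree.fib c k)) :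
    i = k := by
  have h₁ := congrFun h [1]
  have h₂ := congrFun h [0, 1]
  clear h
  revert c i k
  decide

theorem alternatingTree_evalWord_mul {G : Type} [Group G] {gen : Fin 4 → G}
    (hbar : ∀ s, gen (barAD s) = (gen s)⁻¹) (hcube : ∀ s, gen s * gen s = (gen s)⁻¹)
    (c : Fin 2) (u : List (ZMod 2)) (s : Fin 4) :
    ∃ c' u', TreeAction.evalWord gen (alternatingTree.word c u) * gen s =
      TreeAction.evalWord gen (alternatingTree.word c' u') := by
  rcases u with _ | ⟨i, u⟩
  · obtain ⟨c', i', rfl⟩ : ∃ c i, alternatingTree.fib c i = s := by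
      revert s
      decide
    exact ⟨c', [i'], rfl⟩
  · have hs : (∃ c' k, alternatingTree.fib c' k = s ∧ alternatingTree.nxt c' k = c) ∨
        alternatingTree.fib c i = s ∧ alternatingTree.fib c (i + 1) = barAD s ∨
        barAD (alternatingTree.fib c i) = s := by
      revert c i s
      decide
    obtain ⟨c', k, rfl, rfl⟩ | ⟨rfl, h⟩ | rfl := hs
    · exact ⟨c', k :: i :: u, rfl⟩
    · refine ⟨c, (i + 1) :: u, ?_⟩
      change TreeAction.evalWord gen _ * _ * _ = TreeAction.evalWord gen _ * _
      rw [h, hbar, mul_assoc, hcube]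
      rfl
    · refine ⟨alternatingTree.nxt c i, u, ?_⟩
      change TreeAction.evalWord gen _ * _ * _ = _
      rw [hbar, mul_inv_cancel_right]

theorem reducedTree_evalWord_mul {G : Type} [Group G] {gen : Fin 4 → G}
    (hbar : ∀ x, gen (barAD x) = (gen x)⁻¹) (c : Fin 4) (u : List (ZMod 3)) (x : Fin 4) :
    ∃ c' u', TreeAction.evalWord gen (reducedTree.word c u) * gen x =
      TreeAction.evalWord gen (reducedTree.word c' u') := by
  rcases u with _ | ⟨i, u⟩
  · obtain ⟨c', i', rfl⟩ : ∃ c i, reducedTree.fib c i = x := by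
      revert x
      decide
    exact ⟨c', [i'], rfl⟩
  · have hx : (∃ c' k l, reducedTree.fib c' k = x ∧
        reducedTree.fib (reducedTree.nxt c' k) l = reducedTree.fib c i ∧
        reducedTree.nxt (reducedTree.nxt c' k) l = reducedTree.nxt c i) ∨
        barAD (reducedTree.fib c i) = x := by
      revert c i x
      decide
    obtain ⟨c', k, l, rfl, h₁, h₂⟩ | rfl := hx
    · refine ⟨c', k :: l :: u, ?_⟩
      simp only [TreeAction.word, h₁, h₂]
      rfl
    · refine ⟨reducedTree.nxt c i, u, ?_⟩
      change TreeAction.evalWord gen _ * _ * _ = _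
      rw [hbar, mul_inv_cancel_right]

/-- The generators of `C₃ * C₃` corresponding to the states of `A_D`. -/
def coprodGen : Fin 4 → Monoid.Coprod (Multiplicative (ZMod 3)) (Multiplicative (ZMod 3)) :=
  ![.inl (.ofAdd 1), .inr (.ofAdd 1), (.inl (.ofAdd 1))⁻¹, (.inr (.ofAdd 1))⁻¹]

/-- The elements of the free group corresponding to the letters of `A_D`. -/
def freeGen : Fin 4 → FreeGroup (Fin 2) :=
  ![.of 0, .of 1, (.of 0)⁻¹, (.of 1)⁻¹]

theorem coprodGen_bar (s : Fin 4) : coprodGen (barAD s) = (coprodGen s)⁻¹ := by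
  fin_cases s <;> simp [coprodGen, barAD]

theorem freeGen_bar (x : Fin 4) : freeGen (barAD x) = (freeGen x)⁻¹ := by
  fin_cases x <;> simp [freeGen, barAD]

theorem coprodGen_mul_self (s : Fin 4) : coprodGen s * coprodGen s = (coprodGen s)⁻¹ := by
  have h : (.ofAdd 1 * .ofAdd 1 : Multiplicative (ZMod 3)) = (.ofAdd 1)⁻¹ := by decide
  fin_cases s <;> simp [coprodGen, ← mul_inv_rev, ← map_mul, ← map_inv, h]

theorem closure_range_coprodGen : Subgroup.closure (Set.range coprodGen) = ⊤ := by
  have hz (z : Multiplicative (ZMod 3)) : z = .ofAdd 1 ^ z.toAdd.val := by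
    revert z
    decide
  rw [eq_top_iff, ← Monoid.Coprod.closure_range_inl_union_inr, Subgroup.closure_le]
  rintro _ (⟨z, rfl⟩ | ⟨z, rfl⟩) <;> rw [hz z, map_pow] <;>
    refine pow_mem (Subgroup.subset_closure ?_) _
  · exact ⟨0, rfl⟩
  · exact ⟨1, rfl⟩

theorem closure_range_freeGen : Subgroup.closure (Set.range freeGen) = ⊤ := by
  rw [eq_top_iff, ← FreeGroup.closure_range_of, Subgroup.closure_le]
  rintro _ ⟨i, rfl⟩
  refine Subgroup.subset_closure ?_
  fin_cases i
  · exact ⟨0, rfl⟩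
  · exact ⟨1, rfl⟩

theorem exists_monoidHom_zmod {G : Type} [Group G] {n : ℕ} {g : G} (hg : g ^ n = 1) :
    ∃ f : Multiplicative (ZMod n) →* G, f (.ofAdd 1) = g := by
  let φ : ℤ →+ Additive G := zmultiplesHom _ (.ofMul g)
  have hφ : φ n = 0 := by
    simp [φ, ← ofMul_pow, hg]
  refine ⟨AddMonoidHom.toMultiplicativeLeft (ZMod.lift n ⟨φ, hφ⟩), ?_⟩
  have h := ZMod.lift_coe n ⟨φ, hφ⟩ 1
  simp only [Int.cast_one] at h
  simp [h, φ]

theorem coe_inv_eq_of_leftInverse {A : Type} {π : Equiv.Perm A} {f g : A → A} (hπ : ⇑π = f)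
    (hg : ∀ a, f (g a) = a) : ⇑π⁻¹ = g :=
  funext fun a => π.injective (by simp [hπ, hg])


/-- The automaton group of `A_D` is `C₃ * C₃` and its dual automaton group is the
free group `F₂`: the permutations `α = σ_a`, `β = σ_b` satisfy `α³ = β³ = 1` and give a
faithful representation of `C₃ * C₃`, and the dual permutations `ξ = τ_x`, `η = τ_y`
generate a free group of rank 2. -/
theorem AD_groups (α β : Equiv.Perm (List (Fin 4)))
    (hα : ⇑α = AD.actWord 0) (hβ : ⇑β = AD.actWord 1) :
    α ^ 3 = 1 ∧ β ^ 3 = 1 ∧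
    (∃ F : Monoid.Coprod (Multiplicative (ZMod 3)) (Multiplicative (ZMod 3)) →*
        Equiv.Perm (List (Fin 4)),
      F (Monoid.Coprod.inl (Multiplicative.ofAdd (1 : ZMod 3))) = α ∧
      F (Monoid.Coprod.inr (Multiplicative.ofAdd (1 : ZMod 3))) = β ∧
      Function.Injective F) ∧
    (∀ ξ η : Equiv.Perm (List (Fin 4)),
      ⇑ξ = AD.dualActWord 0 → ⇑η = AD.dualActWord 1 →
      Function.Injective
        (FreeGroup.lift ![ξ, η] : FreeGroup (Fin 2) →* Equiv.Perm (List (Fin 4)))) := by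
  have hα3 : α ^ 3 = 1 := Equiv.ext fun w => by
    simpa [pow_succ, hα] using AD_actWord_cube 0 w
  have hβ3 : β ^ 3 = 1 := Equiv.ext fun w => by
    simpa [pow_succ, hβ] using AD_actWord_cube 1 w
  refine ⟨hα3, hβ3, ?_, fun ξ η hξ hη => ?_⟩
  · obtain ⟨f, hf⟩ := exists_monoidHom_zmod hα3
    obtain ⟨g, hg⟩ := exists_monoidHom_zmod hβ3
    refine ⟨Monoid.Coprod.lift f g, by simpa using hf, by simpa using hg, ?_⟩
    have hα' := coe_inv_eq_of_leftInverse hα (AD_actWord_bar 2)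
    have hβ' := coe_inv_eq_of_leftInverse hβ (AD_actWord_bar 3)
    refine alternatingTree.injective_of_transitive (fun s => ?_) alternatingTree_fib_injective
      alternatingTree_transitive coprodGen barAD coprodGen_bar closure_range_coprodGen 0
      (alternatingTree_evalWord_mul coprodGen_bar coprodGen_mul_self) _ fun s => ?_
    · revert s
      decide
    · fin_cases s
      · simpa [coprodGen, hf] using hα
      · simpa [coprodGen, hg] using hβ
      · simpa [coprodGen, hf] using hα'
      · simpa [coprodGen, hg] using hβ'
  · have hξ' := coe_inv_eq_of_leftInverse hξ (AD_dualActWord_bar 2)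
    have hη' := coe_inv_eq_of_leftInverse hη (AD_dualActWord_bar 3)
    refine reducedTree.injective_of_transitive (fun x => ?_) reducedTree_fib_injective
      reducedTree_transitive freeGen barAD freeGen_bar closure_range_freeGen 0
      (reducedTree_evalWord_mul freeGen_bar) _ fun x => ?_
    · revert x
      decide
    · rw [funext (dual_actWord AD x)]
      fin_cases x
      · simpa [freeGen] using hξ
      · simpa [freeGen] using hη
      · simpa [freeGen] using hξ'
      · simpa [freeGen] using hη'
end

section
/- Consider the bireversible automaton A_S with state set S = {a, b, A, B} (A, B standing for a⁻¹, b⁻¹) and alphabet X = {x, y, X', Y'} (X', Y' standing for x⁻¹, y⁻¹), with transitions λ(s, input) = (output, next state) given by: from a: x↦(X',b), y↦(Y',B), Y'↦(x,A), X'↦(y,A); from A: y↦(X',a), x↦(Y',a), X'↦(x,B), Y'↦(y,b); from b: X'↦(x,a), Y'↦(X',B), x↦(y,B), y↦(Y',A); from B: x↦(X',A), X'↦(Y',b), y↦(x,b), Y'↦(y,a). Then: (1) the homomorphism FreeGroup (Fin 2) →* Perm(List X) sending the two free generators to the permutations σ_a and σ_b is injective, so the automaton group G_{A_S} is a free group of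 rank 2; and (2) the homomorphism FreeGroup (Fin 2) →* Perm(List S) sending the two free generators to the dual permutations τ_x and τ_y is injective, so the dual automaton group G_{∂A_S} is a free group of rank 2. -/
open Mealy

/-- The bireversible automaton `A_S` associated to the square complex `Δ_S`, with
states `a = 0`, `b = 1`, `a⁻¹ = 2`, `b⁻¹ = 3` and letters
`x = 0`, `y = 1`, `x⁻¹ = 2`, `y⁻¹ = 3`. -/
def AS : Mealy (Fin 4) (Fin 4) where
  o := ![![2, 3, 1, 0], ![1, 3, 0, 2], ![3, 2, 0, 1], ![2, 0, 3, 1]]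
  t := ![![1, 3, 2, 2], ![3, 2, 0, 3], ![0, 0, 3, 1], ![2, 1, 1, 0]]

section Residuals

variable {S X : Type}

/-- The dual automaton, with states and letters exchanged. -/
def Mealy.dual_s17 (M : Mealy S X) : Mealy X S where
  o x s := M.t s x
  t x s := M.o s x

theorem Mealy.dual_actWord_s17 (M : Mealy S X) (x : X) (w : List S) :
    M.dual_s17.actWord x w = M.dualActWord x w := by
  induction w generalizing x with
  | nil => rfl
  | cons s w ih => simp [Mealy.actWord, Mealy.dualActWord, Mealy.dual_s17, ← ih]

/-- The output letter and the residual word of states when a word of states, whose last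
letter acts first, reads the letter `x`. -/
def Mealy.residual (M : Mealy S X) : List S → X → X × List S
  | [], x => (x, [])
  | s :: l, x =>
    (M.o s (M.residual l x).1, M.t s (M.residual l x).1 :: (M.residual l x).2)

theorem Mealy.length_residual (M : Mealy S X) (l : List S) (x : X) :
    (M.residual l x).2.length = l.length := by
  induction l with
  | nil => rfl
  | cons s l ih => simp [Mealy.residual, ih]

theorem Mealy.foldr_actWord_cons (M : Mealy S X) (l : List S) (x : X) (w : List X) :
    l.foldr M.actWord (x :: w) =
      (M.residual l x).1 :: (M.residual l x).2.foldr M.actWord w := by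
  induction l with
  | nil => rfl
  | cons s l ih => simp [Mealy.residual, Mealy.actWord, ih]

/-- A compatible pair of families in a monoid turns residuals into an exchange relation. -/
theorem Mealy.prod_mul_residual {A : Type*} [Monoid A] (M : Mealy S X) {P : S → A} {Q : X → A}
    (hPQ : ∀ s x, P s * Q x = Q (M.o s x) * P (M.t s x)) (l : List S) (x : X) :
    (l.map P).prod * Q x = Q (M.residual l x).1 * ((M.residual l x).2.map P).prod := by
  induction l with
  | nil => simp [Mealy.residual]
  | cons s l ih =>
    simp only [Mealy.residual, List.map_cons, List.prod_cons]
    rw [mul_assoc, ih, ← mul_assoc, hPQ, mul_assoc]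

/-- If a word of states acts trivially, its value commutes with a positive power of the value
of each letter. -/
theorem Mealy.exists_commute_pow [Finite S] {A : Type*} [Monoid A] (M : Mealy S X)
    {P : S → A} {Q : X → A} (hPQ : ∀ s x, P s * Q x = Q (M.o s x) * P (M.t s x))
    {l : List S} (hl : ∀ w, l.foldr M.actWord w = w) (x : X) (hx : IsRightRegular (Q x)) :
    ∃ m : ℕ, Commute (l.map P).prod (Q x ^ (m + 1)) := by
  let f : List S → List S := fun k => (M.residual k x).2
  have hlen : ∀ n, (f^[n] l).length = l.length := fun n => by
    induction n with
    | zero => rfl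
    | succ n ih => rw [Function.iterate_succ_apply', M.length_residual, ih]
  have htriv : ∀ n w, (f^[n] l).foldr M.actWord w = w := fun n => by
    induction n with
    | zero => exact hl
    | succ n ih =>
      intro w
      have h := ih (x :: w)
      rw [M.foldr_actWord_cons] at h
      rw [Function.iterate_succ_apply']
      exact (List.cons.inj h).2
  have hmul : ∀ n, (l.map P).prod * Q x ^ n = Q x ^ n * ((f^[n] l).map P).prod := fun n => by
    induction n with
    | zero => simp
    | succ n ih =>
      have h := htriv n [x]
      rw [M.foldr_actWord_cons] at h
      rw [pow_succ, ← mul_assoc, ih, mul_assoc, M.prod_mul_residual hPQ, (List.cons.inj h).1,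
        Function.iterate_succ_apply', mul_assoc]
  obtain ⟨i, -, j, -, hij, h⟩ := Set.infinite_univ.exists_lt_map_eq_of_mapsTo
    (f := fun n : ℕ => f^[n] l) (t := {k : List S | k.length = l.length})
    (fun n _ => hlen n) (List.finite_length_eq S l.length)
  obtain ⟨m, rfl⟩ := Nat.exists_eq_add_of_lt hij
  refine ⟨m, (hx.pow i) ?_⟩
  have h' : f^[i] l = f^[i + m + 1] l := h
  have e : i + m + 1 = (m + 1) + i := by ring
  calc (l.map P).prod * Q x ^ (m + 1) * Q x ^ i
      = (l.map P).prod * Q x ^ (i + m + 1) := by rw [mul_assoc, ← pow_add, e]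
    _ = Q x ^ (m + 1) * (Q x ^ i * ((f^[i] l).map P).prod) := by
        rw [hmul, ← h', e, pow_add, mul_assoc]
    _ = Q x ^ (m + 1) * (l.map P).prod * Q x ^ i := by rw [← hmul, mul_assoc]

end Residuals

section QuaternionMatrices

variable {R : Type*} [CommRing R]

/-- The quaternion `1 + (p + q i) F` with `F ^ 2 = s ^ 2`, `i ^ 2 = -1`, as a matrix. -/
def quatMat (s p q : R) : Matrix (Fin 2) (Fin 2) R :=
  !![1 + s * p, -(s * q); -(s * q), 1 - s * p]

theorem quatMat_map {R' : Type*} [CommRing R'] (φ : R →+* R') (s p q : R) :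
    φ.mapMatrix (quatMat s p q) = quatMat (φ s) (φ p) (φ q) := by
  ext i j
  fin_cases i <;> fin_cases j <;> simp [quatMat]

theorem quatMat_mul_eq (s : R) {p q p' q' u v u' v' : R} (h₁ : p + p' = u + u')
    (h₂ : q + q' = v + v') (h₃ : p * p' + q * q' = u * u' + v * v')
    (h₄ : p * q' - q * p' = u * v' - v * u') :
    quatMat s p q * quatMat s p' q' = quatMat s u v * quatMat s u' v' := by
  ext i j
  fin_cases i <;> fin_cases j <;> simp [quatMat, Matrix.mul_apply, Fin.sum_univ_two]
  · linear_combination s * h₁ + s ^ 2 * h₃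
  · linear_combination -s * h₂ - s ^ 2 * h₄
  · linear_combination -s * h₂ + s ^ 2 * h₄
  · linear_combination -s * h₁ + s ^ 2 * h₃

theorem quatMat_det (s p q : R) : (quatMat s p q).det = 1 - s ^ 2 * (p ^ 2 + q ^ 2) := by
  simp [quatMat, Matrix.det_fin_two]
  ring

theorem quatMat_sq (s p q : R) :
    quatMat s p q * quatMat s p q =
      (2 : R) • quatMat s p q - (1 - s ^ 2 * (p ^ 2 + q ^ 2)) • 1 := by
  ext i j
  fin_cases i <;> fin_cases j <;> simp [quatMat, Matrix.mul_apply, Fin.sum_univ_two] <;> ring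

theorem exists_pow_eq_of_mul_self_eq {A : Type*} [Ring A] [Algebra R A] {B : A} {τ d : R}
    (hB : B * B = τ • B - d • 1) (m : ℕ) :
    ∃ e f : R, B ^ (m + 1) = (τ ^ m + d * e) • B + (d * f) • 1 := by
  induction m with
  | zero => exact ⟨0, 0, by simp⟩
  | succ m ih =>
    obtain ⟨e, f, h⟩ := ih
    refine ⟨τ * e + f, -(τ ^ m + d * e), ?_⟩
    rw [pow_succ, h, add_mul, smul_mul_assoc, hB, smul_mul_assoc, one_mul]
    module

variable [IsDomain R]

theorem Commute.of_pow_of_mul_self_eq {A : Type*} [Ring A] [Algebra R A]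
    [Module.IsTorsionFree R A] {B W : A} {τ d : R}
    (hB : B * B = τ • B - d • 1) (hτ : IsUnit τ) (hd : ¬ IsUnit d) {m : ℕ}
    (h : Commute W (B ^ (m + 1))) : Commute W B := by
  obtain ⟨e, f, hm⟩ := exists_pow_eq_of_mul_self_eq hB m
  have hne : τ ^ m + d * e ≠ 0 := fun h0 =>
    hd (isUnit_of_dvd_unit ⟨-e, by linear_combination h0⟩ (hτ.pow m))
  have h1 : Commute W ((τ ^ m + d * e) • B) := by
    have := h.sub_right ((Commute.one_right W).smul_right (d * f))
    rwa [hm, add_sub_cancel_right] at this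
  apply smul_right_injective A hne
  simpa [Commute, SemiconjBy] using h1

/-- A matrix commuting with two independent quaternions is scalar. -/
theorem eq_smul_one_of_commute_quatMat {s p q p' q' : R} (hs : s ≠ 0) (h2 : (2 : R) ≠ 0)
    (hind : p * q' - q * p' ≠ 0) {W : Matrix (Fin 2) (Fin 2) R}
    (h : Commute W (quatMat s p q)) (h' : Commute W (quatMat s p' q')) :
    W = W 0 0 • (1 : Matrix (Fin 2) (Fin 2) R) := by
  have entries : ∀ {p q : R}, Commute W (quatMat s p q) →
      q * (W 0 0 - W 1 1) + 2 * p * W 0 1 = 0 ∧ q * (W 0 0 - W 1 1) + 2 * p * W 1 0 = 0 := by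
    intro p q h
    have h01 := congrFun (congrFun h.eq 0) 1
    have h10 := congrFun (congrFun h.eq 1) 0
    simp [quatMat, Matrix.mul_apply, Fin.sum_univ_two] at h01 h10
    constructor <;> apply mul_left_cancel₀ hs
    · linear_combination -h01
    · linear_combination h10
  obtain ⟨e₁, e₂⟩ := entries h
  obtain ⟨e₁', e₂'⟩ := entries h'
  have hd : W 0 0 - W 1 1 = 0 := by
    apply mul_left_cancel₀ hind
    linear_combination p * e₁' - p' * e₁
  have h01 : W 0 1 = 0 := by
    apply mul_left_cancel₀ (mul_ne_zero h2 hind)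
    linear_combination q' * e₁ - q * e₁'
  have h10 : W 1 0 = 0 := by
    apply mul_left_cancel₀ (mul_ne_zero h2 hind)
    linear_combination q' * e₂ - q * e₂'
  ext i j
  fin_cases i <;> fin_cases j <;> simp [h01, h10]
  linear_combination -hd

end QuaternionMatrices

section FreeFactor

open Polynomial

/-- The inverse of a generator in the numbering `a, b, a⁻¹, b⁻¹`. -/
def invLetter : Fin 4 → Fin 4 := ![2, 3, 0, 1]

/-- The number of a signed generator in the numbering `a, b, a⁻¹, b⁻¹`. -/
def letterOf (c : Fin 2 × Bool) : Fin 4 :=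
  ![![2, 0] (if c.2 then 1 else 0), ![3, 1] (if c.2 then 1 else 0)] c.1

/-- Real parts of the quaternion coefficients `1, -i, -1, i`. -/
def unitRe : Fin 4 → ZMod 3 := ![1, 0, -1, 0]

/-- Imaginary parts of the quaternion coefficients `1, -i, -1, i`. -/
def unitIm : Fin 4 → ZMod 3 := ![0, -1, 0, 1]

/-- The images of the singular matrices `quatMat 1 (unitRe s) (unitIm s)`. -/
def unitImage : Fin 4 → Fin 2 → ZMod 3 := ![![1, 0], ![1, 1], ![0, 1], ![1, -1]]

theorem exists_prod_mulVec_eq (s : Fin 4) (l : List (Fin 4))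
    (hl : (s :: l).IsChain fun s s' => s' ≠ invLetter s) :
    ∃ v, (((s :: l).map fun s => quatMat 1 (unitRe s) (unitIm s)).prod).mulVec v
      = unitImage s := by
  induction l generalizing s with
  | nil =>
    have h : ∀ s, (quatMat 1 (unitRe s) (unitIm s)).mulVec (-unitImage s) = unitImage s := by
      decide
    exact ⟨-unitImage s, by simpa using h s⟩
  | cons s' l ih =>
    rw [List.isChain_cons_cons] at hl
    obtain ⟨v, hv⟩ := ih s' hl.2
    have key : ∀ s s', s' ≠ invLetter s →
        ∃ c : ZMod 3, (quatMat 1 (unitRe s) (unitIm s)).mulVec (c • unitImage s')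
          = unitImage s := by
      decide
    obtain ⟨c, hc⟩ := key s s' hl.1
    refine ⟨c • v, ?_⟩
    rw [List.map_cons, List.prod_cons, ← Matrix.mulVec_mulVec, Matrix.mulVec_smul, hv, hc]

/-- A nonempty reduced product of the quaternions `1 + βF` with `β` of norm one is not
scalar. -/
theorem prod_quatMat_ne_smul_one {l : List (Fin 4)} (hne : l ≠ [])
    (hl : l.IsChain fun s s' => s' ≠ invLetter s) (r : (ZMod 3)[X]) :
    (l.map fun s => quatMat X (C (unitRe s)) (C (unitIm s))).prod ≠
      r • (1 : Matrix (Fin 2) (Fin 2) (ZMod 3)[X]) := by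
  intro h
  obtain ⟨s, l, rfl⟩ := List.exists_cons_of_ne_nil hne
  obtain ⟨v, hv⟩ := exists_prod_mulVec_eq s l hl
  have h1 : ((s :: l).map fun s => quatMat 1 (unitRe s) (unitIm s)).prod =
      (eval 1 r) • (1 : Matrix (Fin 2) (Fin 2) (ZMod 3)) := by
    have h2 := congrArg (evalRingHom (1 : ZMod 3)).mapMatrix h
    rw [map_list_prod, List.map_map] at h2
    have e : (⇑(evalRingHom (1 : ZMod 3)).mapMatrix ∘
        fun s => quatMat X (C (unitRe s)) (C (unitIm s))) =
        fun s => quatMat 1 (unitRe s) (unitIm s) := by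
      funext s
      simp only [Function.comp_apply, quatMat_map, coe_evalRingHom, eval_X, eval_C]
    rw [e] at h2
    rw [h2]
    ext i j
    fin_cases i <;> fin_cases j <;> simp
  have hdet : ∀ s, (quatMat 1 (unitRe s) (unitIm s)).det = 0 := by decide
  have hr : eval 1 r = 0 := by
    have h3 := congrArg Matrix.det h1
    rw [List.map_cons, List.prod_cons, Matrix.det_mul, hdet, zero_mul, Matrix.det_smul] at h3
    simpa using h3.symm
  rw [h1, hr, zero_smul, Matrix.zero_mulVec] at hv
  exact (by decide : ∀ s, (0 : Fin 2 → ZMod 3) ≠ unitImage s) s hv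

theorem not_isUnit_one_add_X_sq : ¬ IsUnit (1 + X ^ 2 : (ZMod 3)[X]) := by
  intro h
  have hdeg : (1 + X ^ 2 : (ZMod 3)[X]).natDegree = 2 := by compute_degree!
  rw [natDegree_eq_zero_of_isUnit h] at hdeg
  omega

/-- The squares of the automaton hold for the quaternions `1 + βF` at the states, with `β`
given by `unitRe` and `unitIm`, and `1 + (p + q i)F` at the letters. -/
abbrev Mealy.QuatRelations (M : Mealy (Fin 4) (Fin 4)) (p q : Fin 4 → ZMod 3) : Prop :=
  ∀ s x,
    unitRe s + p x = p (M.o s x) + unitRe (M.t s x) ∧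
    unitIm s + q x = q (M.o s x) + unitIm (M.t s x) ∧
    unitRe s * p x + unitIm s * q x =
      p (M.o s x) * unitRe (M.t s x) + q (M.o s x) * unitIm (M.t s x) ∧
    unitRe s * q x - unitIm s * p x =
      p (M.o s x) * unitIm (M.t s x) - q (M.o s x) * unitRe (M.t s x)

/-- A word of states acting trivially is not a nonempty reduced word, provided the states and
letters satisfy the relations of quaternions `1 + βF` with `β` of norm `1` and `-1`. -/
theorem Mealy.eq_nil_of_foldr_actWord_eq (M : Mealy (Fin 4) (Fin 4)) {p q : Fin 4 → ZMod 3}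
    (hrel : M.QuatRelations p q)
    (hnorm : ∀ x, p x ^ 2 + q x ^ 2 = -1) (hind : p 0 * q 1 - q 0 * p 1 ≠ 0)
    {l : List (Fin 4)} (hl : l.IsChain fun s s' => s' ≠ invLetter s)
    (htriv : ∀ w, l.foldr M.actWord w = w) : l = [] := by
  by_contra hne
  have htwo : IsUnit (2 : ZMod 3) := by decide
  have : Fact (Nat.Prime 3) := ⟨by norm_num⟩
  let P : Fin 4 → Matrix (Fin 2) (Fin 2) (ZMod 3)[X] :=
    fun s => quatMat X (C (unitRe s)) (C (unitIm s))
  let Q : Fin 4 → Matrix (Fin 2) (Fin 2) (ZMod 3)[X] := fun x => quatMat X (C (p x)) (C (q x))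
  have hPQ : ∀ s x, P s * Q x = Q (M.o s x) * P (M.t s x) := by
    intro s x
    obtain ⟨h₁, h₂, h₃, h₄⟩ := hrel s x
    apply quatMat_mul_eq <;> simp only [← C_add, ← C_mul, ← C_sub, h₁, h₂, h₃, h₄]
  have hdet : ∀ x, 1 - X ^ 2 * (C (p x) ^ 2 + C (q x) ^ 2) = (1 + X ^ 2 : (ZMod 3)[X]) := by
    intro x
    rw [← C_pow, ← C_pow, ← C_add, hnorm, C_neg, C_1]
    ring
  have hreg : ∀ x, IsRightRegular (Q x) := by
    intro x B B' h
    have h1 := congrArg (· * (Q x).adjugate) h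
    simp only [mul_assoc, Matrix.mul_adjugate, Matrix.mul_smul, mul_one] at h1
    rw [quatMat_det, hdet] at h1
    refine smul_right_injective _ (fun h0 => ?_) h1
    have := congrArg (eval 0) h0
    simp at this
  have hcomm : ∀ x, Commute (l.map P).prod (Q x) := by
    intro x
    obtain ⟨m, hm⟩ := M.exists_commute_pow hPQ htriv x (hreg x)
    have hsq := quatMat_sq X (C (p x)) (C (q x))
    rw [hdet] at hsq
    refine hm.of_pow_of_mul_self_eq hsq ?_ not_isUnit_one_add_X_sq
    exact isUnit_C.2 htwo
  refine prod_quatMat_ne_smul_one hne hl _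
    (eq_smul_one_of_commute_quatMat X_ne_zero ?_ ?_ (hcomm 0) (hcomm 1))
  · exact C_ne_zero.2 htwo.ne_zero
  · rw [← C_mul, ← C_mul, ← C_sub]
    exact C_ne_zero.2 hind

theorem Mealy.actWord_invLetter (M : Mealy (Fin 4) (Fin 4))
    (hinv : ∀ s x, M.o (invLetter s) (M.o s x) = x ∧
      M.t (invLetter s) (M.o s x) = invLetter (M.t s x)) (s : Fin 4) (w : List (Fin 4)) :
    M.actWord (invLetter s) (M.actWord s w) = w := by
  induction w generalizing s with
  | nil => rfl
  | cons x w ih => simp [Mealy.actWord, hinv, ih]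

theorem Mealy.lift_injective (M : Mealy (Fin 4) (Fin 4)) {p q : Fin 4 → ZMod 3}
    (hrel : M.QuatRelations p q)
    (hnorm : ∀ x, p x ^ 2 + q x ^ 2 = -1) (hind : p 0 * q 1 - q 0 * p 1 ≠ 0)
    (hinv : ∀ s x, M.o (invLetter s) (M.o s x) = x ∧
      M.t (invLetter s) (M.o s x) = invLetter (M.t s x))
    (σ : Fin 2 → Equiv.Perm (List (Fin 4)))
    (h₀ : ⇑(σ 0) = M.actWord 0) (h₁ : ⇑(σ 1) = M.actWord 1) :
    Function.Injective (FreeGroup.lift σ) := by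
  have hσ : ∀ c : Fin 2 × Bool,
      ⇑(cond c.2 (σ c.1) (σ c.1)⁻¹) = M.actWord (letterOf c) := by
    have hinv' : ∀ (s : Fin 4) (π : Equiv.Perm (List (Fin 4))), ⇑π = M.actWord s →
        ⇑π⁻¹ = M.actWord (invLetter s) := by
      intro s π hπ
      funext w
      rw [Equiv.Perm.inv_eq_iff_eq, hπ]
      have hs : invLetter (invLetter s) = s :=
        (by decide : ∀ s, invLetter (invLetter s) = s) s
      have := M.actWord_invLetter hinv (invLetter s) w
      rw [hs] at this
      exact this.symm
    rintro ⟨i, b⟩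
    fin_cases i <;> cases b
    · exact hinv' 0 _ h₀
    · exact h₀
    · exact hinv' 1 _ h₁
    · exact h₁
  rw [injective_iff_map_eq_one]
  intro g hg
  have hword : ∀ (L : List (Fin 2 × Bool)) (w : List (Fin 4)),
      FreeGroup.lift σ (FreeGroup.mk L) w = (L.map letterOf).foldr M.actWord w := by
    intro L w
    rw [FreeGroup.lift_mk]
    induction L with
    | nil => rfl
    | cons c L ih => simp [ih, hσ]
  have hchain : (g.toWord.map letterOf).IsChain fun s s' => s' ≠ invLetter s := by
    rw [List.isChain_map]
    have key : ∀ c c' : Fin 2 × Bool, (c.1 = c'.1 → c.2 = c'.2) →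
        letterOf c' ≠ invLetter (letterOf c) := by decide
    exact FreeGroup.isReduced_toWord.imp fun {c c'} h => key c c' h
  have hnil := M.eq_nil_of_foldr_actWord_eq hrel hnorm hind hchain fun w => by
    rw [← hword, FreeGroup.mk_toWord, hg]
    rfl
  rwa [List.map_eq_nil_iff, FreeGroup.toWord_eq_nil_iff] at hnil

end FreeFactor

/-- Both the automaton group and the dual automaton group of `A_S` are free of rank 2:
the permutations `σ_a`, `σ_b` freely generate a free group, and likewise the dual
permutations `τ_x`, `τ_y`. -/
theorem AS_groups (σa σb : Equiv.Perm (List (Fin 4)))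
    (hσa : ⇑σa = AS.actWord 0) (hσb : ⇑σb = AS.actWord 1)
    (τx τy : Equiv.Perm (List (Fin 4)))
    (hτx : ⇑τx = AS.dualActWord 0) (hτy : ⇑τy = AS.dualActWord 1) :
    Function.Injective
      (FreeGroup.lift ![σa, σb] : FreeGroup (Fin 2) →* Equiv.Perm (List (Fin 4))) ∧
    Function.Injective
      (FreeGroup.lift ![τx, τy] : FreeGroup (Fin 2) →* Equiv.Perm (List (Fin 4))) := by
  constructor
  · exact AS.lift_injective (p := ![1, 1, -1, -1]) (q := ![1, -1, -1, 1]) (by decide) (by decide)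
      (by decide) (by decide) _ hσa hσb
  · exact AS.dual_s17.lift_injective (p := ![-1, 1, 1, -1]) (q := ![1, 1, -1, -1]) (by decide)
      (by decide) (by decide) (by decide) _
      (hτx.trans (funext fun w => (AS.dual_actWord_s17 0 w).symm))
      (hτy.trans (funext fun w => (AS.dual_actWord_s17 1 w).symm))
end

section
/- Let G_S be the presented group on generators a, b, x, y with the four relations a x = x⁻¹ b, a y = y⁻¹ b⁻¹, a y⁻¹ = x a⁻¹, b x = y b⁻¹. Then each of the pairs (a,x), (a,y), (b,x), (b,y) forms an anti-torus in G_S: for all nonzero integers n, m one has aⁿxᵐ ≠ xᵐaⁿ, aⁿyᵐ ≠ yᵐaⁿ, bⁿxᵐ ≠ xᵐbⁿ, and bⁿyᵐ ≠ yᵐbⁿ. -/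
namespace SComplex

/-- Relators of `π₁(Δ_S)` on the generators `a = 0`, `b = 1`, `x = 2`, `y = 3`,
encoding the relations `a x = x⁻¹ b`, `a y = y⁻¹ b⁻¹`, `a y⁻¹ = x a⁻¹`, `b x = y b⁻¹`. -/
def relsS : Set (FreeGroup (Fin 4)) :=
  { FreeGroup.of 0 * FreeGroup.of 2 * (FreeGroup.of 1)⁻¹ * FreeGroup.of 2,
    FreeGroup.of 0 * FreeGroup.of 3 * FreeGroup.of 1 * FreeGroup.of 3,
    FreeGroup.of 0 * (FreeGroup.of 3)⁻¹ * FreeGroup.of 0 * (FreeGroup.of 2)⁻¹,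
    FreeGroup.of 1 * FreeGroup.of 2 * FreeGroup.of 1 * (FreeGroup.of 3)⁻¹ }

/-- The fundamental group `G_S = π₁(Δ_S)`. -/
abbrev GS := PresentedGroup relsS

/-- The generator `a` of `G_S`. -/
def a : GS := PresentedGroup.of 0
/-- The generator `b` of `G_S`. -/
def b : GS := PresentedGroup.of 1
/-- The generator `x` of `G_S`. -/
def x : GS := PresentedGroup.of 2
/-- The generator `y` of `G_S`. -/
def y : GS := PresentedGroup.of 3

end SComplex

open Matrix Polynomial
open scoped MatrixGroups

namespace SComplex

/-- In `GL₂` over a field, two elements commuting with a common non-central element commute. -/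
theorem commute_of_commute_notMem_center {K : Type*} [Field K] {g s t : GL (Fin 2) K}
    (hg : g ∉ Subgroup.center (GL (Fin 2) K)) (hs : Commute g s) (ht : Commute g t) :
    Commute s t := by
  have hns : ¬ (g.val 0 1 = 0 ∧ g.val 1 0 = 0 ∧ g.val 0 0 = g.val 1 1) := by
    rintro ⟨h01, h10, h00⟩
    refine hg (GeneralLinearGroup.mem_center_iff_val_mem_range_scalar.mpr ⟨g.val 0 0, ?_⟩)
    ext i j
    fin_cases i <;> fin_cases j <;> simp [h01, h10, h00]
  have hs' := congrArg Units.val hs.eq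
  have ht' := congrArg Units.val ht.eq
  refine Units.ext ?_
  simp only [Units.val_mul, ← Matrix.ext_iff, Fin.forall_fin_two, Matrix.mul_apply,
    Fin.sum_univ_two] at hs' ht' ⊢
  grind

/-- If the commutator of two elements of `GL₂` over a field is central, then the first element
commutes with the square of the second. -/
theorem commute_sq_of_mk_commute {K : Type*} [Field K] {g h : GL (Fin 2) K}
    (hc : Commute (ProjGenLinGroup.mk g) (ProjGenLinGroup.mk h)) : Commute g (h ^ 2) := by
  have hc' : ProjGenLinGroup.mk (h * g) = ProjGenLinGroup.mk (g * h) := by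
    simpa using hc.eq.symm
  obtain ⟨u, hu⟩ := ProjGenLinGroup.mk_eq_mk_iff.mp hc'
  have hdet := congrArg GeneralLinearGroup.det hu
  have hu2 : u ^ 2 = 1 := by
    rw [map_mul, map_mul, map_mul, mul_comm (GeneralLinearGroup.det h),
      GeneralLinearGroup.det_scalar, Fintype.card_fin] at hdet
    simpa using hdet
  set z := GeneralLinearGroup.scalar (Fin 2) u with hz
  have hz2 : z * z = 1 := by
    rw [hz, ← map_mul, ← sq, hu2, map_one]
  have hzh : z * h = h * z := GeneralLinearGroup.scalar_commute u h
  calc g * h ^ 2 = (g * h) * h := by rw [sq, mul_assoc]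
    _ = h * g * (z * h) := by rw [← hu, mul_assoc (h * g)]
    _ = h * (g * h) * z := by rw [hzh]; group
    _ = h * h * g * (z * z) := by rw [← hu]; group
    _ = h ^ 2 * g := by rw [hz2, mul_one, sq]

/-- If no positive power of `g` or `h` is central and some nontrivial powers of the images of
`g` and `h` in `PGL₂` commute, then `g` and `h` commute. -/
theorem commute_of_mk_pow_commute {K : Type*} [Field K] {g h : GL (Fin 2) K}
    (hg : ∀ n : ℕ, n ≠ 0 → g ^ n ∉ Subgroup.center (GL (Fin 2) K))
    (hh : ∀ n : ℕ, n ≠ 0 → h ^ n ∉ Subgroup.center (GL (Fin 2) K))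
    {n m : ℕ} (hn : n ≠ 0) (hm : m ≠ 0)
    (hc : Commute (ProjGenLinGroup.mk g ^ n) (ProjGenLinGroup.mk h ^ m)) : Commute g h := by
  rw [← map_pow, ← map_pow] at hc
  have h1 := commute_sq_of_mk_commute hc
  rw [← pow_mul] at h1
  have h2 : Commute g (h ^ (m * 2)) :=
    commute_of_commute_notMem_center (hg n hn) (Commute.pow_self g n) h1
  exact commute_of_commute_notMem_center (hh (m * 2) (by omega)) h2.symm (Commute.pow_self h _)

/-- A `2 × 2` matrix over a field with zero determinant and nonzero trace has no scalar
positive powers. -/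
theorem pow_not_scalar_of_det_eq_zero {L : Type*} [Field L] {N : Matrix (Fin 2) (Fin 2) L}
    (hdet : N.det = 0) (htr : N.trace ≠ 0) (n : ℕ) (hn : n ≠ 0) :
    ¬ ((N ^ n) 0 1 = 0 ∧ (N ^ n) 1 0 = 0 ∧ (N ^ n) 0 0 = (N ^ n) 1 1) := by
  rintro ⟨h01, h10, h00⟩
  have hsq : N * N = N.trace • N := by
    rw [Matrix.det_fin_two] at hdet
    ext i j
    fin_cases i <;> fin_cases j <;>
      simp [Matrix.mul_apply, Fin.sum_univ_two, Matrix.trace_fin_two] <;> grind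
  have hpow : ∀ k : ℕ, N ^ (k + 1) = N.trace ^ k • N := by
    intro k
    induction k with
    | zero => simp
    | succ k ih => rw [pow_succ, ih, smul_mul_assoc, hsq, smul_smul, pow_succ]
  obtain ⟨k, rfl⟩ := Nat.exists_eq_succ_of_ne_zero hn
  have hd : (N ^ (k + 1)).det = 0 := by rw [Matrix.det_pow, hdet, zero_pow hn]
  have ht : (N ^ (k + 1)).trace = N.trace ^ (k + 1) := by
    rw [hpow, Matrix.trace_smul, smul_eq_mul, pow_succ]
  have hne : (N ^ (k + 1)).trace ≠ 0 := ht ▸ pow_ne_zero _ htr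
  rw [Matrix.det_fin_two] at hd
  rw [Matrix.trace_fin_two] at hne
  simp only [Nat.succ_eq_add_one] at h01 h10 h00
  grind

/-- An element of `GL₂` proportional to a matrix over a subring has no central positive powers
when some specialization of that matrix is singular with nonzero trace. -/
theorem pow_notMem_center {R K L : Type*} [CommRing R] [Field K] [Field L] {f : R →+* K}
    (hf : Function.Injective f) (e : R →+* L) {M : Matrix (Fin 2) (Fin 2) R}
    (hdet : (M.map e).det = 0) (htr : (M.map e).trace ≠ 0) {g : GL (Fin 2) K} {c : K}
    (hc : c ≠ 0) (hg : g.val = c • M.map f) (n : ℕ) (hn : n ≠ 0) :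
    g ^ n ∉ Subgroup.center (GL (Fin 2) K) := by
  intro hmem
  obtain ⟨u, hu⟩ := GeneralLinearGroup.mem_center_iff_val_mem_range_scalar.mp hmem
  have hpow : M.map f ^ n = (M ^ n).map f := (map_pow f.mapMatrix M n).symm
  have hpow' : M.map e ^ n = (M ^ n).map e := (map_pow e.mapMatrix M n).symm
  rw [Units.val_pow_eq_pow_val, hg, _root_.smul_pow, hpow] at hu
  have hent : ∀ i j, Matrix.scalar (Fin 2) u i j = c ^ n * f ((M ^ n) i j) := by
    intro i j
    rw [hu]
    simp
  have hcn : c ^ n ≠ 0 := pow_ne_zero _ hc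
  have h01 : (M ^ n) 0 1 = 0 := by
    have := hent 0 1
    refine hf ?_
    simpa [hn, hc, eq_comm] using this
  have h10 : (M ^ n) 1 0 = 0 := by
    have := hent 1 0
    refine hf ?_
    simpa [hn, hc, eq_comm] using this
  have h00 : (M ^ n) 0 0 = (M ^ n) 1 1 := by
    refine hf (mul_left_cancel₀ hcn ?_)
    rw [← hent, ← hent]
    simp
  refine pow_not_scalar_of_det_eq_zero hdet htr n hn ?_
  rw [hpow']
  simp [h01, h10, h00]

/-- The matrix representing `a`, over the ring `R` with parameter `v`. -/
def matA {R : Type*} [CommRing R] (v : R) : Matrix (Fin 2) (Fin 2) R :=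
  !![0, -(1 + v ^ 2); 1, 1]

/-- The matrix representing `x`, over the ring `R` with parameter `v`. -/
def matX {R : Type*} [CommRing R] (v : R) : Matrix (Fin 2) (Fin 2) R :=
  !![1 + v, v * (1 - v); 0, 1 - v]

theorem det_matA {R : Type*} [CommRing R] (v : R) : (matA v).det = 1 + v ^ 2 := by
  simp [matA, Matrix.det_fin_two]

theorem det_matX {R : Type*} [CommRing R] (v : R) : (matX v).det = (1 + v) * (1 - v) := by
  simp [matX, Matrix.det_fin_two]

theorem matA_map {R S : Type*} [CommRing R] [CommRing S] (f : R →+* S) (v : R) :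
    (matA v).map f = matA (f v) := by
  ext i j
  fin_cases i <;> fin_cases j <;> simp [matA]

theorem matX_map {R S : Type*} [CommRing R] [CommRing S] (f : R →+* S) (v : R) :
    (matX v).map f = matX (f v) := by
  ext i j
  fin_cases i <;> fin_cases j <;> simp [matX]

theorem adjugate_matX_map {R S : Type*} [CommRing R] [CommRing S] (f : R →+* S) (v : R) :
    (matX v).adjugate.map f = (matX (f v)).adjugate := by
  rw [← matX_map]
  exact RingHom.map_adjugate f (matX v)

/-- In characteristic three, the last relation of `G_S` holds up to a scalar. -/
theorem matB_mul_matX_mul_matB {R : Type*} [CommRing R] (h3 : (3 : R) = 0) (v : R) :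
    (matX v * matA v * matX v) * matX v * (matX v * matA v * matX v) =
      ((1 + v) * (1 - v)) ^ 2 • (matA v * (matX v).adjugate * matA v) := by
  ext i j
  fin_cases i <;> fin_cases j <;>
    simp [matA, matX, Matrix.adjugate_fin_two, Matrix.mul_apply, Fin.sum_univ_two] <;> grind

/-- In characteristic three, the second relation of `G_S` holds up to a scalar. -/
theorem matA_mul_matY_mul_matB_mul_matY {R : Type*} [CommRing R] (h3 : (3 : R) = 0) (v : R) :
    matA v * (matA v * (matX v).adjugate * matA v) * (matX v * matA v * matX v) *
      (matA v * (matX v).adjugate * matA v) =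
      ((1 + v ^ 2) ^ 3 * ((1 + v) * (1 - v)) ^ 2) • (1 : Matrix (Fin 2) (Fin 2) R) := by
  ext i j
  fin_cases i <;> fin_cases j <;>
    simp [matA, matX, Matrix.adjugate_fin_two, Matrix.mul_apply, Fin.sum_univ_two] <;> grind


/-- An element of `GL₂` whose underlying matrix is a scalar multiple of the identity is trivial in
`PGL₂`. -/
theorem mk_eq_one_of_val_eq_smul {K : Type*} [Field K] {g : GL (Fin 2) K} {c : K}
    (h : g.val = c • (1 : Matrix (Fin 2) (Fin 2) K)) : ProjGenLinGroup.mk g = 1 := by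
  refine ProjGenLinGroup.mk_eq_one.mpr
    (GeneralLinearGroup.mem_center_iff_val_mem_range_scalar.mpr ⟨c, ?_⟩)
  rw [h, Matrix.smul_one_eq_diagonal, Matrix.scalar_apply]

/-- A homomorphism from `G_S` to `PGL₂(K)` is obtained from two elements of `GL₂(K)` satisfying
two of the relations up to scalars. -/
theorem exists_hom_projGenLinGroup {K : Type*} [Field K] {g h : GL (Fin 2) K}
    (hr₂ : ProjGenLinGroup.mk (g * (g * h⁻¹ * g) * (h * g * h) * (g * h⁻¹ * g)) = 1)
    (hr₄ : ProjGenLinGroup.mk ((h * g * h) * h * (h * g * h) * (g * h⁻¹ * g)⁻¹) = 1) :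
    ∃ φ : GS →* PGL(2, K), φ a = ProjGenLinGroup.mk g ∧ φ b = ProjGenLinGroup.mk (h * g * h) ∧
      φ x = ProjGenLinGroup.mk h ∧ φ y = ProjGenLinGroup.mk (g * h⁻¹ * g) := by
  let F : Fin 4 → PGL(2, K) := ![ProjGenLinGroup.mk g, ProjGenLinGroup.mk (h * g * h),
    ProjGenLinGroup.mk h, ProjGenLinGroup.mk (g * h⁻¹ * g)]
  have hF : ∀ r ∈ relsS, FreeGroup.lift F r = 1 := by
    intro r hr
    simp only [relsS, Set.mem_insert_iff, Set.mem_singleton_iff] at hr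
    rcases hr with rfl | rfl | rfl | rfl
    · simp only [map_mul, map_inv, FreeGroup.lift_apply_of, F, Matrix.cons_val]
      group
    · simpa only [map_mul, map_inv, FreeGroup.lift_apply_of, F, Matrix.cons_val] using hr₂
    · simp only [map_mul, map_inv, FreeGroup.lift_apply_of, F, Matrix.cons_val]
      group
    · simpa only [map_mul, map_inv, FreeGroup.lift_apply_of, F, Matrix.cons_val] using hr₄
  exact ⟨PresentedGroup.toGroup hF, PresentedGroup.toGroup.of hF, PresentedGroup.toGroup.of hF,
    PresentedGroup.toGroup.of hF, PresentedGroup.toGroup.of hF⟩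

/-- If nonzero integer powers of two elements commute, then so do some positive powers. -/
theorem exists_pow_commute_of_zpow_commute {G : Type*} [Group G] {g h : G} {n m : ℤ} (hn : n ≠ 0)
    (hm : m ≠ 0) (hc : Commute (g ^ n) (h ^ m)) :
    ∃ k l : ℕ, k ≠ 0 ∧ l ≠ 0 ∧ Commute (g ^ k) (h ^ l) := by
  refine ⟨n.natAbs, m.natAbs, Int.natAbs_ne_zero.mpr hn, Int.natAbs_ne_zero.mpr hm, ?_⟩
  rw [← zpow_natCast, ← zpow_natCast]
  rcases Int.natAbs_eq n with h₁ | h₁ <;> rcases Int.natAbs_eq m with h₂ | h₂ <;>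
    rw [h₁, h₂] at hc <;> simpa using hc

/-- Over a field `K` containing a polynomial ring `F[X]` in characteristic three, with `-1` a square
in `F`, there are a projective representation of `G_S` in degree two and lifts of the images of the
generators such that no positive power of a lift is central and the lifts of `a`, `b` do not commute
with those of `x`, `y`. -/
theorem exists_projective_representation {F K : Type*} [Field F] [Field K] (f : F[X] →+* K)
    (hf : Function.Injective f) (h3F : (3 : F) = 0) {i : F} (hi : i ^ 2 = -1) :
    ∃ (φ : GS →* PGL(2, K)) (gA gB gX gY : GL (Fin 2) K),
      φ a = ProjGenLinGroup.mk gA ∧ φ b = ProjGenLinGroup.mk gB ∧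
      φ x = ProjGenLinGroup.mk gX ∧ φ y = ProjGenLinGroup.mk gY ∧
      (∀ n : ℕ, n ≠ 0 → gA ^ n ∉ Subgroup.center (GL (Fin 2) K)) ∧
      (∀ n : ℕ, n ≠ 0 → gB ^ n ∉ Subgroup.center (GL (Fin 2) K)) ∧
      (∀ n : ℕ, n ≠ 0 → gX ^ n ∉ Subgroup.center (GL (Fin 2) K)) ∧
      (∀ n : ℕ, n ≠ 0 → gY ^ n ∉ Subgroup.center (GL (Fin 2) K)) ∧
      ¬ Commute gA gX ∧ ¬ Commute gA gY ∧ ¬ Commute gB gX ∧ ¬ Commute gB gY := by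
  have h2F : (2 : F) ≠ 0 := by
    intro h
    exact one_ne_zero (α := F) (by linear_combination h3F - h)
  have h3 : (3 : K) = 0 := by
    have : f (C (3 : F)) = 3 := by rw [map_ofNat, map_ofNat]
    rw [← this, h3F, map_zero, map_zero]
  set v : K := f X with hv
  have eval_ne : ∀ (p : F[X]) (t : F), p.eval t ≠ 0 → f p ≠ 0 := by
    intro p t ht hp
    refine ht ?_
    rw [(map_eq_zero_iff f hf).mp hp, eval_zero]
  have hd : 1 + v ^ 2 ≠ 0 := by
    have := eval_ne (1 + X ^ 2) 0 (by simp)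
    simpa [hv] using this
  have hδ : (1 + v) * (1 - v) ≠ 0 := by
    have := eval_ne ((1 + X) * (1 - X)) 0 (by simp)
    simpa [hv] using this
  let gA := GeneralLinearGroup.mkOfDetNeZero (matA v) (by rwa [det_matA])
  let gX := GeneralLinearGroup.mkOfDetNeZero (matX v) (by rwa [det_matX])
  have hA : gA.val = matA v := rfl
  have hX : gX.val = matX v := rfl
  have hXi : (gX⁻¹).val = ((1 + v) * (1 - v))⁻¹ • (matX v).adjugate := by
    rw [← det_matX, Matrix.coe_units_inv, hX, Matrix.inv_def, Ring.inverse_eq_inv']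
  have hB : (gX * gA * gX).val = matX v * matA v * matX v := rfl
  have hY : (gA * gX⁻¹ * gA).val =
      ((1 + v) * (1 - v))⁻¹ • (matA v * (matX v).adjugate * matA v) := by
    rw [Units.val_mul, Units.val_mul, hXi, hA, Matrix.mul_smul, Matrix.smul_mul]
  set δ := (1 + v) * (1 - v)
  have hBXB : ((gX * gA * gX) * gX * (gX * gA * gX)).val =
      δ ^ 3 • (gA * gX⁻¹ * gA).val := by
    rw [Units.val_mul, Units.val_mul _ gX, hB, hX, matB_mul_matX_mul_matB h3, hY, smul_smul]
    congr 1
    rw [pow_succ δ 2, mul_assoc, mul_inv_cancel₀ hδ, mul_one]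
  have hr₂ : ProjGenLinGroup.mk
      (gA * (gA * gX⁻¹ * gA) * (gX * gA * gX) * (gA * gX⁻¹ * gA)) = 1 := by
    refine mk_eq_one_of_val_eq_smul (c := δ⁻¹ * δ⁻¹ * ((1 + v ^ 2) ^ 3 * δ ^ 2)) ?_
    rw [Units.val_mul, Units.val_mul _ (gX * gA * gX), Units.val_mul gA, hB, hY, hA]
    simp only [Matrix.mul_smul, Matrix.smul_mul]
    rw [matA_mul_matY_mul_matB_mul_matY h3, smul_smul, smul_smul]
  have hr₄ : ProjGenLinGroup.mk
      ((gX * gA * gX) * gX * (gX * gA * gX) * (gA * gX⁻¹ * gA)⁻¹) = 1 := by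
    refine mk_eq_one_of_val_eq_smul (c := δ ^ 3) ?_
    rw [Units.val_mul, hBXB, Matrix.smul_mul]
    exact congrArg (fun w : GL (Fin 2) K => δ ^ 3 • w.val) (mul_inv_cancel (gA * gX⁻¹ * gA))
  obtain ⟨φ, ha, hb, hx, hy⟩ := exists_hom_projGenLinGroup hr₂ hr₄
  have hAX : ¬ Commute gA gX := by
    intro h
    have h' : (gA * gX).val 1 0 = (gX * gA).val 1 0 := by rw [h.eq]
    have h0 : v = 0 := by
      simp only [Units.val_mul, hA, hX] at h'
      simp [matA, matX, Matrix.mul_apply, Fin.sum_univ_two] at h'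
      grind
    exact eval_ne X 1 (by simp) h0
  have hBX : ¬ Commute (gX * gA * gX) gX := by
    intro h
    refine hAX ?_
    have h' : gX * (gA * gX) * gX = gX * (gX * gA) * gX := by simpa [mul_assoc] using h.eq
    exact mul_left_cancel (mul_right_cancel h')
  have hAY : ¬ Commute gA (gA * gX⁻¹ * gA) := by
    intro h
    refine hAX ?_
    have h' : gA * (gA * gX⁻¹) * gA = gA * (gX⁻¹ * gA) * gA := by simpa [mul_assoc] using h.eq
    have h'' : Commute gA gX⁻¹ := mul_left_cancel (mul_right_cancel h')
    simpa using h''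
  have hBY : ¬ Commute (gX * gA * gX) (gA * gX⁻¹ * gA) := by
    intro h
    refine hBX ?_
    have h' : Commute (gX * gA * gX) ((gX * gA * gX) * gX * (gX * gA * gX)) := by
      refine Units.ext ?_
      have := congrArg Units.val h.eq
      rw [Units.val_mul (gX * gA * gX), Units.val_mul (gA * gX⁻¹ * gA)] at this
      rw [Units.val_mul (gX * gA * gX) (gX * gA * gX * gX * (gX * gA * gX)),
        Units.val_mul (gX * gA * gX * gX * (gX * gA * gX)), hBXB, Matrix.mul_smul,
        Matrix.smul_mul, this]
    have h'' : (gX * gA * gX) * ((gX * gA * gX) * gX) * (gX * gA * gX) =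
        (gX * gA * gX) * (gX * (gX * gA * gX)) * (gX * gA * gX) := by
      simpa [mul_assoc] using h'.eq
    exact mul_left_cancel (mul_right_cancel h'')
  have hcA : gA.val = (1 : K) • (matA (X : F[X])).map f := by rw [one_smul, matA_map, hA]
  have hcX : gX.val = (1 : K) • (matX (X : F[X])).map f := by rw [one_smul, matX_map, hX]
  have hcB : (gX * gA * gX).val =
      (1 : K) • (matX (X : F[X]) * matA X * matX X).map f := by
    rw [one_smul, Matrix.map_mul, Matrix.map_mul, matA_map, matX_map, hB]
  have hcY : (gA * gX⁻¹ * gA).val =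
      δ⁻¹ • (matA (X : F[X]) * (matX X).adjugate * matA X).map f := by
    rw [Matrix.map_mul, Matrix.map_mul, matA_map, adjugate_matX_map, hY]
  refine ⟨φ, gA, gX * gA * gX, gX, gA * gX⁻¹ * gA, ha, hb, hx, hy,
    pow_notMem_center hf (evalRingHom i) ?_ ?_ one_ne_zero hcA,
    pow_notMem_center hf (evalRingHom i) ?_ ?_ one_ne_zero hcB,
    pow_notMem_center hf (evalRingHom 1) ?_ ?_ one_ne_zero hcX,
    pow_notMem_center hf (evalRingHom 1) ?_ ?_ (inv_ne_zero hδ) hcY, hAX, hAY, hBX, hBY⟩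
  · rw [matA_map, det_matA, coe_evalRingHom, eval_X, hi, add_neg_cancel]
  · rw [matA_map]
    simp [matA, Matrix.trace_fin_two]
  · rw [Matrix.map_mul, Matrix.map_mul, matA_map, Matrix.det_mul, Matrix.det_mul, det_matA,
      coe_evalRingHom, eval_X, hi, add_neg_cancel, mul_zero, zero_mul]
  · rw [Matrix.map_mul, Matrix.map_mul, matA_map, matX_map, coe_evalRingHom, eval_X]
    simp [matA, matX, Matrix.trace_fin_two]
    grind
  · rw [matX_map, det_matX, coe_evalRingHom, eval_X, sub_self, mul_zero]
  · rw [matX_map, coe_evalRingHom, eval_X]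
    simp [matX, Matrix.trace_fin_two]
    grind
  · rw [Matrix.map_mul, Matrix.map_mul, adjugate_matX_map, Matrix.det_mul, Matrix.det_mul,
      Matrix.det_adjugate, det_matX, coe_evalRingHom, eval_X]
    simp
  · rw [Matrix.map_mul, Matrix.map_mul, matA_map, adjugate_matX_map, coe_evalRingHom, eval_X]
    simp [matA, matX, Matrix.adjugate_fin_two, Matrix.trace_fin_two]
    grind

end SComplex

open SComplex in
/-- Each of the pairs `(a,x)`, `(a,y)`, `(b,x)`, `(b,y)` forms an anti-torus in `G_S`. -/
theorem GS_antitori :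
    ∀ n m : ℤ, n ≠ 0 → m ≠ 0 →
      a ^ n * x ^ m ≠ x ^ m * a ^ n ∧
      a ^ n * y ^ m ≠ y ^ m * a ^ n ∧
      b ^ n * x ^ m ≠ x ^ m * b ^ n ∧
      b ^ n * y ^ m ≠ y ^ m * b ^ n := by
  intro n m hn hm
  let F := AlgebraicClosure (ZMod 3)
  let K := FractionRing F[X]
  have h3F : (3 : F) = 0 := by
    have h : algebraMap (ZMod 3) F 3 = 3 := map_ofNat _ 3
    rw [← h, show (3 : ZMod 3) = 0 from by decide, map_zero]
  obtain ⟨i, hi⟩ := IsAlgClosed.exists_pow_nat_eq (-1 : F) (n := 2) (by norm_num)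
  obtain ⟨φ, gA, gB, gX, gY, ha, hb, hx, hy, hA, hB, hX, hY, hAX, hAY, hBX, hBY⟩ :=
    exists_projective_representation (algebraMap F[X] K) (IsFractionRing.injective F[X] K) h3F hi
  have key : ∀ {s t : GS} {g h : GL (Fin 2) K}, φ s = ProjGenLinGroup.mk g →
      φ t = ProjGenLinGroup.mk h → (∀ n : ℕ, n ≠ 0 → g ^ n ∉ Subgroup.center (GL (Fin 2) K)) →
      (∀ n : ℕ, n ≠ 0 → h ^ n ∉ Subgroup.center (GL (Fin 2) K)) → ¬ Commute g h →
      s ^ n * t ^ m ≠ t ^ m * s ^ n := by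
    intro s t g h hs ht hg hh hgh hc
    have hc' := Commute.map (show Commute (s ^ n) (t ^ m) from hc) φ
    rw [map_zpow, map_zpow, hs, ht] at hc'
    obtain ⟨k, l, hk, hl, hkl⟩ := exists_pow_commute_of_zpow_commute hn hm hc'
    exact hgh (commute_of_mk_pow_commute hg hh hk hl hkl)
  exact ⟨key ha hx hA hX hAX, key ha hy hA hY hAY, key hb hx hB hX hBX, key hb hy hB hY hBY⟩
end
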